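/- arXiv:2412.08417 — 2 statements merged into one kernel-verified Lean document; each statement's English description precedes it below -/
import Mathlib

section
/- Let G be a simple graph on n ≥ 6 vertices that is θ(1,2,2)-free. Then the signless Laplacian spectral radius satisfies q(G) ≤ q(F_n), with equality only if G is isomorphic to F_n. -/
open SimpleGraph Finset

/-- The signless Laplacian spectral radius of a graph: the largest real eigenvalue
(root of the characteristic polynomial) of `Q(G) = D(G) + A(G)`. -/
noncomputable def qrad {n : ℕ} (G : SimpleGraph (Fin n)) : ℝ :=
  letI := Classical.decRel G.Adj
  sSup {x : ℝ | (Matrix.charpoly (G.degMatrix ℝ + G.adjMatrix ℝ)).IsRoot x}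

/-- `contains H G` : `G` contains a subgraph isomorphic to `H`. -/
def contains {α β : Type*} (H : SimpleGraph α) (G : SimpleGraph β) : Prop :=
  ∃ f : α → β, Function.Injective f ∧ ∀ a b, H.Adj a b → G.Adj (f a) (f b)

/-- The theta graph θ(1,2,2) (= K₄ minus an edge). -/
def theta122 : SimpleGraph (Fin 4) :=
  SimpleGraph.fromEdgeSet {s(0,1), s(0,2), s(1,2), s(0,3), s(1,3)}

/-- The theta graph θ(1,2,3). -/
def theta123 : SimpleGraph (Fin 5) :=
  SimpleGraph.fromEdgeSet {s(0,1), s(0,2), s(2,1), s(0,3), s(3,4), s(4,1)}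

/-- The friendship graph `F n`: center `0`; the other vertices are paired up
`{1,2}, {3,4}, …` into triangles through the center, with a pendant vertex left
over when `n` is even. -/
def friendship (n : ℕ) : SimpleGraph (Fin n) :=
  SimpleGraph.fromRel (fun i j => i.val = 0 ∨ (i.val + 1) / 2 = (j.val + 1) / 2)

/-- `Sgraph n k` = `S_{n,k}`, the join of `K_k` with `n - k` isolated vertices. -/
def Sgraph (n k : ℕ) : SimpleGraph (Fin n) :=
  SimpleGraph.fromRel (fun i _ => i.val < k)

/-- `Splus n` = `S_{n,1}⁺`, the star `K_{1,n-1}` plus one edge between two leaves. -/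
def Splus (n : ℕ) : SimpleGraph (Fin n) :=
  SimpleGraph.fromRel (fun i j => i.val = 0 ∨ (i.val = 1 ∧ j.val = 2))

/-- `K₁ ∨ ((n-1)/3) K₃` : vertex `0` joined to `(n-1)/3` disjoint triangles. -/
def joinK3s (n : ℕ) : SimpleGraph (Fin n) :=
  SimpleGraph.fromRel (fun i j => i.val = 0 ∨ (i.val - 1) / 3 = (j.val - 1) / 3)

/-- The number of edges of `G` lying inside the vertex set `s` (the number of
edges of the induced subgraph `G[s]`). -/
noncomputable def edgesIn {V : Type*} (G : SimpleGraph V) (s : Set V) : ℕ :=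
  {e | e ∈ G.edgeSet ∧ ∀ v ∈ e, v ∈ s}.ncard


/-- The neighbourhood of `i` as a finset. -/
noncomputable def nb {n : ℕ} (G : SimpleGraph (Fin n)) (i : Fin n) : Finset (Fin n) := by
  classical exact univ.filter (G.Adj i)

theorem mem_nb {n : ℕ} (G : SimpleGraph (Fin n)) (i j : Fin n) : j ∈ nb G i ↔ G.Adj i j := by
  classical simp [nb]

theorem isRoot_iff {n : ℕ} (G : SimpleGraph (Fin n)) (x : ℝ) (inst : DecidableRel G.Adj) :
    (Matrix.charpoly (G.degMatrix ℝ + G.adjMatrix ℝ)).IsRoot x ↔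
      ∃ z : Fin n → ℝ, z ≠ 0 ∧ ∀ i, ∑ j ∈ nb G i, (z i + z j) = x * z i := by
  rw [Polynomial.IsRoot.def, Matrix.eval_charpoly, ← Matrix.exists_mulVec_eq_zero_iff]
  apply exists_congr
  intro z
  apply and_congr Iff.rfl
  rw [funext_iff]
  apply forall_congr'
  intro i
  have hN : G.neighborFinset i = nb G i := by
    ext j; simp [mem_nb]
  rw [Matrix.sub_mulVec, Matrix.add_mulVec, Pi.sub_apply, Pi.add_apply,
    SimpleGraph.degMatrix_mulVec_apply, SimpleGraph.adjMatrix_mulVec_apply,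
    Finset.sum_add_distrib, Finset.sum_const, ← SimpleGraph.card_neighborFinset_eq_degree, hN]
  have : (Matrix.scalar (Fin n) x).mulVec z i = x * z i := by
    simp [Matrix.scalar_apply, Matrix.mulVec_diagonal]
  rw [this, nsmul_eq_mul, Pi.zero_apply]
  constructor <;> intro h <;> linarith

theorem root_le {n : ℕ} (G : SimpleGraph (Fin n)) (y : Fin n → ℝ) (hy : ∀ i, 0 < y i) (c : ℝ)
    (h : ∀ i, ∑ j ∈ nb G i, (y i + y j) ≤ c * y i) (x : ℝ)
    (z : Fin n → ℝ) (hz : z ≠ 0) (hx : ∀ i, ∑ j ∈ nb G i, (z i + z j) = x * z i) : x ≤ c := by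
  obtain ⟨k, hk⟩ : ∃ k, z k ≠ 0 := by
    by_contra! hh; exact hz (funext hh)
  obtain ⟨i, -, hi⟩ := Finset.exists_max_image univ (fun j => |z j| / y j) ⟨k, mem_univ k⟩
  set r := |z i| / y i with hr
  have hle : ∀ j, |z j| ≤ r * y j := fun j => (div_le_iff₀ (hy j)).1 (hi j (mem_univ j))
  have heq : |z i| = r * y i := by rw [hr]; field_simp [(hy i).ne']
  have hrpos : 0 < r := lt_of_lt_of_le (div_pos (abs_pos.2 hk) (hy k)) (hi k (mem_univ k))
  have h1 : x * |z i| ≤ c * |z i| := by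
    calc x * |z i| ≤ |x * z i| := by rw [abs_mul]; gcongr; exact le_abs_self x
      _ = |∑ j ∈ nb G i, (z i + z j)| := by rw [hx]
      _ ≤ ∑ j ∈ nb G i, |z i + z j| := Finset.abs_sum_le_sum_abs _ _
      _ ≤ ∑ j ∈ nb G i, r * (y i + y j) := by
          apply Finset.sum_le_sum
          intro j _
          have := abs_add_le (z i) (z j)
          have := hle j
          linarith
      _ = r * ∑ j ∈ nb G i, (y i + y j) := by rw [Finset.mul_sum]
      _ ≤ r * (c * y i) := by gcongr; exact h i
      _ = c * |z i| := by rw [heq]; ring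
  have : 0 < |z i| := by rw [heq]; exact mul_pos hrpos (hy i)
  exact le_of_mul_le_mul_right h1 this

theorem qrad_le {n : ℕ} (G : SimpleGraph (Fin n)) (y : Fin n → ℝ) (hy : ∀ i, 0 < y i) (c : ℝ)
    (hc : 0 ≤ c) (h : ∀ i, ∑ j ∈ nb G i, (y i + y j) ≤ c * y i) : qrad G ≤ c := by
  unfold qrad
  apply Real.sSup_le _ hc
  intro x hx
  obtain ⟨z, hz, hx⟩ := (isRoot_iff G x _).1 hx
  exact root_le G y hy c h x z hz hx

theorem qrad_eq {n : ℕ} (hn : 0 < n) (G : SimpleGraph (Fin n)) (y : Fin n → ℝ) (hy : ∀ i, 0 < y i)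
    (c : ℝ) (hc : 0 ≤ c) (h : ∀ i, ∑ j ∈ nb G i, (y i + y j) = c * y i) : qrad G = c := by
  apply le_antisymm (qrad_le G y hy c hc fun i => (h i).le)
  unfold qrad
  apply le_csSup
  · refine ⟨c, ?_⟩
    intro x hx
    obtain ⟨z, hz, hx⟩ := (isRoot_iff G x _).1 hx
    exact root_le G y hy c (fun i => (h i).le) x z hz hx
  · refine (isRoot_iff G c _).2 ⟨y, ?_, h⟩
    intro h0
    have := hy ⟨0, hn⟩
    rw [h0] at this
    simp at this

theorem no_diamond {n : ℕ} (G : SimpleGraph (Fin n)) (hfree : ¬ contains theta122 G)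
    {a b c d : Fin n} (hab : G.Adj a b) (hac : G.Adj a c) (hbc : G.Adj b c) (had : G.Adj a d)
    (hbd : G.Adj b d) : c = d := by
  by_contra hcd
  apply hfree
  refine ⟨![a, b, c, d], ?_, ?_⟩
  · have h1 := hab.ne
    have h2 := hac.ne
    have h3 := hbc.ne
    have h4 := had.ne
    have h5 := hbd.ne
    intro i j hij
    fin_cases i <;> fin_cases j <;> simp_all
  · intro i j hij
    fin_cases i <;> fin_cases j <;> simp [theta122] at hij ⊢ <;>
      first | assumption | (apply SimpleGraph.Adj.symm; assumption)

/-- `σ` is the partner involution of the neighbourhood of `u`. -/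
structure Partner {n : ℕ} (G : SimpleGraph (Fin n)) (u : Fin n) (σ : Equiv.Perm (Fin n)) : Prop where
  invol : ∀ v, σ (σ v) = v
  out : ∀ v, ¬ G.Adj u v → σ v = v
  adj : ∀ v, σ v ≠ v → G.Adj v (σ v)
  mem : ∀ v, G.Adj u v → G.Adj u (σ v)
  uniq : ∀ v w, G.Adj u v → G.Adj u w → G.Adj v w → σ v = w

theorem exists_partner {n : ℕ} (G : SimpleGraph (Fin n)) (u : Fin n)
    (hu : ∀ v w w', G.Adj u v → G.Adj u w → G.Adj u w' → G.Adj v w → G.Adj v w' → w = w') :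
    ∃ σ, Partner G u σ := by
  classical
  let f : Fin n → Fin n := fun v =>
    if h : ∃ w, G.Adj u v ∧ G.Adj u w ∧ G.Adj v w then h.choose else v
  have hf1 : ∀ v w, G.Adj u v → G.Adj u w → G.Adj v w → f v = w := by
    intro v w h1 h2 h3
    have h : ∃ w, G.Adj u v ∧ G.Adj u w ∧ G.Adj v w := ⟨w, h1, h2, h3⟩
    have : f v = h.choose := by simp only [f]; rw [dif_pos h]
    rw [this]
    have hs := h.choose_spec
    exact hu v _ _ h1 hs.2.1 h2 hs.2.2 h3
  have hf2 : ∀ v, f v = v ∨ (G.Adj u v ∧ G.Adj u (f v) ∧ G.Adj v (f v)) := by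
    intro v
    by_cases h : ∃ w, G.Adj u v ∧ G.Adj u w ∧ G.Adj v w
    · right
      have : f v = h.choose := by simp only [f]; rw [dif_pos h]
      rw [this]
      exact h.choose_spec
    · left; simp only [f]; rw [dif_neg h]
  have hinv : Function.Involutive f := by
    intro v
    rcases hf2 v with h | ⟨h1, h2, h3⟩
    · rw [h, h]
    · exact hf1 _ _ h2 h1 h3.symm
  refine ⟨hinv.toPerm, ?_, ?_, ?_, ?_, ?_⟩
  · exact hinv
  · intro v hv
    rcases hf2 v with h | h
    · exact h
    · exact absurd h.1 hv
  · intro v hv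
    rcases hf2 v with h | h
    · exact absurd h hv
    · exact h.2.2
  · intro v hv
    rcases hf2 v with h | h
    · change G.Adj u (f v); rw [h]; exact hv
    · exact h.2.1
  · exact hf1

theorem Partner.even {n : ℕ} {G : SimpleGraph (Fin n)} {u : Fin n} {σ : Equiv.Perm (Fin n)}
    (h : Partner G u σ) : 2 ∣ #σ.support := by
  apply Equiv.Perm.two_dvd_card_support
  ext v
  simp [pow_two, h.invol]

theorem Partner.sum_eq {n : ℕ} {G : SimpleGraph (Fin n)} {u : Fin n} {σ : Equiv.Perm (Fin n)}
    (h : Partner G u σ) (f : Fin n → ℝ) : ∑ v ∈ nb G u, f (σ v) = ∑ v ∈ nb G u, f v := by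
  apply Finset.sum_nbij' σ σ
  · intro a ha; rw [mem_nb] at *; exact h.mem a ha
  · intro a ha; rw [mem_nb] at *; exact h.mem a ha
  · intro a _; exact h.invol a
  · intro a _; exact h.invol a
  · intro a _; rfl

theorem Partner.support_subset {n : ℕ} {G : SimpleGraph (Fin n)} {u : Fin n}
    {σ : Equiv.Perm (Fin n)} (h : Partner G u σ) : σ.support ⊆ nb G u := by
  intro v hv
  rw [mem_nb]
  by_contra hh
  exact (Equiv.Perm.mem_support.1 hv) (h.out v hh)

/-- Sums over the neighbourhood that are constant on matched / unmatched vertices. -/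
theorem Partner.sum_ite {n : ℕ} {G : SimpleGraph (Fin n)} {u : Fin n}
    {σ : Equiv.Perm (Fin n)} (h : Partner G u σ) (p r : ℝ) :
    ∑ v ∈ nb G u, (if σ v = v then r else p) =
      #σ.support * p + (#(nb G u) - #σ.support) * r := by
  have h1 : ∀ v ∈ nb G u, (if σ v = v then r else p) = r + (if v ∈ σ.support then p - r else 0) := by
    intro v _
    by_cases hv : σ v = v <;> simp [hv]
  rw [Finset.sum_congr rfl h1, Finset.sum_add_distrib, Finset.sum_const, ← Finset.sum_filter,
    Finset.sum_const, Finset.filter_mem_eq_inter, Finset.inter_eq_right.2 h.support_subset]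
  simp only [nsmul_eq_mul]
  ring

/-- All degrees at most `n - 3`. -/
theorem caseA {n : ℕ} (G : SimpleGraph (Fin n)) (hfree : ¬ contains theta122 G)
    (hd : ∀ i, #(nb G i) + 3 ≤ n) : qrad G ≤ n := by
  have hpos : ∀ i j, G.Adj i j → 0 < #(nb G i) := by
    intro i j hij
    exact Finset.card_pos.2 ⟨j, (mem_nb _ _ _).2 hij⟩
  let y : Fin n → ℝ := fun i => if #(nb G i) = 0 then 1 else #(nb G i)
  have hy : ∀ i j, G.Adj i j → y i = #(nb G i) := by
    intro i j hij
    simp only [y]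
    rw [if_neg (hpos i j hij).ne']
  apply qrad_le G y _ _ (Nat.cast_nonneg n)
  · intro i
    by_cases h0 : #(nb G i) = 0
    · have : nb G i = ∅ := Finset.card_eq_zero.1 h0
      simp [this, y]
    obtain ⟨σ, hσ⟩ := exists_partner G i (fun v w w' h1 h2 h3 h4 h5 =>
      no_diamond G hfree h1 h2 h4 h3 h5)
    have hyi : y i = #(nb G i) := by simp only [y]; rw [if_neg h0]
    have key : ∀ j ∈ nb G i, y j + y (σ j) ≤ 2 * (n - #(nb G i) : ℝ) := by
      intro j hj
      rw [mem_nb] at hj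
      have hj2 := hσ.mem j hj
      rw [hy j i hj.symm, hy _ i hj2.symm]
      have hcompl : #(nb G i)ᶜ + #(nb G i) = n := by
        rw [Finset.card_compl, Fintype.card_fin]
        have := hd i
        omega
      suffices hs : #(nb G j) + #(nb G (σ j)) + 2 * #(nb G i) ≤ 2 * n by
        have : (#(nb G j) + #(nb G (σ j)) + 2 * #(nb G i) : ℝ) ≤ 2 * n := by exact_mod_cast hs
        linarith
      by_cases hm : σ j = j
      · have hsub : nb G j ⊆ (nb G i)ᶜ := by
          intro w hw
          rw [mem_nb] at hw
          rw [Finset.mem_compl, mem_nb]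
          intro hiw
          have := hσ.uniq j w hj hiw hw
          rw [hm] at this
          exact hw.ne this
        have := Finset.card_le_card hsub
        rw [hm]
        omega
      · have hadj := hσ.adj j hm
        have hi1 : #(nb G j ∩ nb G (σ j)) ≤ 1 := by
          rw [Finset.card_le_one]
          intro a ha b hb
          simp only [Finset.mem_inter, mem_nb] at ha hb
          exact no_diamond G hfree hadj ha.1 ha.2 hb.1 hb.2
        have hsub : nb G j ∪ nb G (σ j) ⊆ insert j (insert (σ j) (nb G i)ᶜ) := by
          intro w hw
          simp only [Finset.mem_union, Finset.mem_insert, Finset.mem_compl, mem_nb] at hw ⊢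
          by_cases hiw : G.Adj i w
          · rcases hw with hw | hw
            · right; left; exact (hσ.uniq j w hj hiw hw).symm
            · left
              have := hσ.uniq (σ j) w hj2 hiw hw
              rw [hσ.invol] at this
              exact this.symm
          · right; right; exact hiw
        have h1 := Finset.card_le_card hsub
        have h2 := Finset.card_insert_le j (insert (σ j) (nb G i)ᶜ)
        have h3 := Finset.card_insert_le (σ j) (nb G i)ᶜ
        have h4 := Finset.card_union_add_card_inter (nb G j) (nb G (σ j))
        have := hd i
        omega
    have hs := Finset.sum_le_sum key
    rw [Finset.sum_add_distrib, hσ.sum_eq y, Finset.sum_const, nsmul_eq_mul] at hs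
    rw [Finset.sum_add_distrib, Finset.sum_const, nsmul_eq_mul, hyi]
    nlinarith
  · intro i
    simp only [y]
    split_ifs with h
    · exact one_pos
    · exact_mod_cast Nat.pos_of_ne_zero h

/-- The weights used in the case of a vertex of degree `n - 2`. -/
theorem weights_aux (d t : ℝ) (hd : 4 ≤ d) (ht : 0 < t) (ht1 : t ≤ 1) :
    ∃ b p p' : ℝ, 0 < b ∧ 0 < p ∧ 0 < p' ∧ p' ≤ p ∧ p ≤ 2 * b ∧ d * b = 1 + t ∧
      (d - 1) * p = 1 + p' + t ∧ d * p' = 1 + p ∧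
      p = (d * (1 + t) + 1) / (d ^ 2 - d - 1) := by
  have hD : 0 < d ^ 2 - d - 1 := by nlinarith
  have hd0 : 0 < d := by linarith
  have hD' : d ^ 2 - d - 1 ≠ 0 := hD.ne'
  have hD2 : d * (d - 1) - 1 ≠ 0 := fun h => hD' (by linarith)
  refine ⟨(1 + t) / d, (d * (1 + t) + 1) / (d ^ 2 - d - 1),
    (1 + (d * (1 + t) + 1) / (d ^ 2 - d - 1)) / d, by positivity, by positivity, by positivity,
    ?_, ?_, ?_, ?_, ?_, rfl⟩
  · rw [div_le_iff₀ hd0, ← sub_nonneg]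
    have : (d * (1 + t) + 1) / (d ^ 2 - d - 1) * d - (1 + (d * (1 + t) + 1) / (d ^ 2 - d - 1))
        = (d * t * (d - 1)  + d) / (d ^ 2 - d - 1) := by
      field_simp; ring
    rw [this]
    apply div_nonneg _ hD.le
    have : 0 ≤ d * t * (d - 1) := mul_nonneg (by positivity) (by linarith)
    linarith
  · rw [div_le_iff₀ hD, mul_comm 2, mul_assoc, div_mul_eq_mul_div, le_div_iff₀ hd0]
    nlinarith [mul_nonneg ht.le (by nlinarith : (0:ℝ) ≤ d ^ 2 - 2 * d - 2)]
  · field_simp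
  · field_simp; ring
  · field_simp

theorem weights (d : ℝ) (M : ℕ) (hd : 4 ≤ d) (hM : (M : ℝ) ≤ d) (hev : 2 ∣ M) :
    ∃ t b p p' : ℝ, 0 < t ∧ 0 < b ∧ 0 < p ∧ 0 < p' ∧ p' ≤ p ∧ d * b = 1 + t ∧
      (d - 1) * p = 1 + p' + t ∧ d * p' = 1 + p ∧
      M * ((p + p') / 2) + (d - M) * b ≤ 2 ∧
      M * ((t + p) / 2) + (d - M) * (t + b) ≤ (d + 2) * t := by
  have hD : 0 < d ^ 2 - d - 1 := by nlinarith
  have hd0 : 0 < d := by linarith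
  rcases (by omega : M = 0 ∨ M = 2 ∨ 4 ≤ M) with h | h | h
  · obtain ⟨b, p, p', h1, h2, h3, h4, h5, h6, h7, h8, h9⟩ :=
      weights_aux d 1 hd (by norm_num) (by norm_num)
    refine ⟨1, b, p, p', by norm_num, h1, h2, h3, h4, h6, h7, h8, ?_, ?_⟩ <;> subst h <;>
      push_cast <;> linarith
  · obtain ⟨b, p, p', h1, h2, h3, h4, h5, h6, h7, h8, h9⟩ :=
      weights_aux d (1 / 2) hd (by norm_num) (by norm_num)
    refine ⟨1 / 2, b, p, p', by norm_num, h1, h2, h3, h4, h6, h7, h8, ?_, ?_⟩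
    · subst h
      push_cast
      have : p + p' - 2 * b ≤ 1 / 2 := by
        have e : d * (p + p' - 2 * b) = (d + 1) * p - 2 := by linarith
        have : (d + 1) * p ≤ 2 + d / 2 := by
          rw [h9, mul_div_assoc', div_le_iff₀ hD]
          nlinarith [mul_nonneg (by linarith : (0:ℝ) ≤ d - 4) (by positivity : 0 ≤ d ^ 2), mul_nonneg (by linarith : (0:ℝ) ≤ d - 4) hd0.le]
        by_contra! hh
        nlinarith
      linarith
    · subst h
      push_cast
      linarith
  · obtain ⟨b, p, p', h1, h2, h3, h4, h5, h6, h7, h8, h9⟩ :=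
      weights_aux d (1 / 3) hd (by norm_num) (by norm_num)
    have hM4 : (4 : ℝ) ≤ M := by exact_mod_cast h
    refine ⟨1 / 3, b, p, p', by norm_num, h1, h2, h3, h4, h6, h7, h8, ?_, ?_⟩
    · have e : d * ((p + p') / 2 - b) = ((d + 1) * p + 1) / 2 - 4 / 3 := by linarith
      have : (d + 1) * p ≤ 3 := by
        rw [h9, mul_div_assoc', div_le_iff₀ hD]
        nlinarith
      have h10 : d * ((p + p') / 2 - b) ≤ 2 / 3 := by linarith
      have h11 : M * ((p + p') / 2 - b) ≤ 2 / 3 := by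
        rcases le_total 0 ((p + p') / 2 - b) with h | h
        · exact le_trans (mul_le_mul_of_nonneg_right hM h) h10
        · have := mul_nonpos_of_nonneg_of_nonpos (by positivity : (0:ℝ) ≤ M) h
          linarith
      linarith
    · have : (0 : ℝ) ≤ M * (b - p / 2) := mul_nonneg (by positivity) (by linarith)
      linarith

/-- A vertex of degree `n - 2`. -/
theorem caseB {n : ℕ} (hn : 6 ≤ n) (G : SimpleGraph (Fin n)) (hfree : ¬ contains theta122 G)
    (u w : Fin n) (hwu : w ≠ u) (hnadj : ¬ G.Adj u w)
    (hall : ∀ v, v ≠ u → v ≠ w → G.Adj u v) : qrad G ≤ n := by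
  classical
  obtain ⟨σ, hσ⟩ := exists_partner G u (fun v w w' h1 h2 h3 h4 h5 =>
      no_diamond G hfree h1 h2 h4 h3 h5)
  have hnb : nb G u = {u, w}ᶜ := by
    ext v
    simp only [mem_nb, mem_compl, mem_insert, mem_singleton, not_or]
    constructor
    · intro h
      exact ⟨h.ne', fun hv => hnadj (hv ▸ h)⟩
    · rintro ⟨h1, h2⟩; exact hall v h1 h2
  have hcard : #(nb G u) + 2 = n := by
    rw [hnb, Finset.card_compl, Finset.card_pair hwu.symm, Fintype.card_fin]; omega
  have hcardR : (#(nb G u) : ℝ) + 2 = n := by exact_mod_cast hcard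
  obtain ⟨t, b, p, p', ht, hb, hp, hp', hpp, e1, e2, e3, C1, C2⟩ :=
    weights (#(nb G u)) (#σ.support) (by exact_mod_cast (by omega : 4 ≤ #(nb G u)))
      (by exact_mod_cast Finset.card_le_card hσ.support_subset) hσ.even
  set d : ℝ := (#(nb G u) : ℝ) with hd
  set M : ℝ := (#σ.support : ℝ) with hM
  let y : Fin n → ℝ := fun v => if v = u then 1 else if v = w then t else
    if σ v = v then b else if G.Adj v w then p else p'
  have hyu : y u = 1 := by simp [y]
  have hyw : y w = t := by simp [y, hwu]
  have hyv : ∀ v, G.Adj u v → y v = if σ v = v then b else if G.Adj v w then p else p' := by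
    intro v hv
    have h1 : v ≠ u := hv.ne'
    have h2 : v ≠ w := fun h => hnadj (h ▸ hv)
    simp [y, h1, h2]
  have hypos : ∀ v, 0 < y v := by
    intro v
    simp only [y]
    split_ifs <;> first | assumption | exact one_pos
  have hnotboth : ∀ v, G.Adj u v → σ v ≠ v → G.Adj v w → ¬ G.Adj (σ v) w := by
    intro v hv hm h1 h2
    exact hwu (no_diamond G hfree (hσ.adj v hm) h1 h2 hv.symm (hσ.mem v hv).symm)
  refine qrad_le G y hypos _ (Nat.cast_nonneg n) ?_
  intro v
  have hnvu : ∀ v, v = u ∨ v = w ∨ G.Adj u v := by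
    intro v
    by_cases h1 : v = u
    · exact Or.inl h1
    by_cases h2 : v = w
    · exact Or.inr (Or.inl h2)
    exact Or.inr (Or.inr (hall v h1 h2))
  rcases hnvu v with rfl | rfl | hv
  · -- row of the big vertex
    have key : ∀ j ∈ nb G v, y j + y (σ j) ≤ if σ j = j then 2 * b else p + p' := by
      intro j hj
      rw [mem_nb] at hj
      rw [hyv j hj, hyv _ (hσ.mem j hj), hσ.invol]
      by_cases hm : σ j = j
      · simp [hm]; linarith
      · have hm' : ¬ j = σ j := fun h => hm h.symm
        rw [if_neg hm, if_neg hm', if_neg hm]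
        by_cases h1 : G.Adj j w
        · rw [if_pos h1, if_neg (hnotboth j hj hm h1)]
        · rw [if_neg h1]
          split_ifs <;> linarith
    have hs := Finset.sum_le_sum key
    rw [Finset.sum_add_distrib, hσ.sum_eq y, hσ.sum_ite] at hs
    rw [Finset.sum_add_distrib, Finset.sum_const, nsmul_eq_mul, hyu]
    linarith
  · -- row of the non-neighbour
    have hsum : ∑ j ∈ nb G v, (y v + y j) = ∑ j ∈ nb G u, if G.Adj j v then y v + y j else 0 := by
      rw [← Finset.sum_filter]
      apply Finset.sum_congr _ (fun _ _ => rfl)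
      ext j
      simp only [mem_nb, mem_filter]
      constructor
      · intro h
        refine ⟨hall j ?_ h.ne', h.symm⟩
        rintro rfl
        exact hnadj h.symm
      · intro h; exact h.2.symm
    rw [hsum]
    let g : Fin n → ℝ := fun j => if G.Adj j v then y v + y j else 0
    have key : ∀ j ∈ nb G u, g j + g (σ j) ≤ if σ j = j then 2 * (t + b) else t + p := by
      intro j hj
      rw [mem_nb] at hj
      simp only [g]
      rw [hyv j hj, hyv _ (hσ.mem j hj), hσ.invol, hyw]
      by_cases hm : σ j = j
      · simp only [hm, if_true]
        split_ifs <;> linarith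
      · have hm' : ¬ j = σ j := fun h => hm h.symm
        rw [if_neg hm, if_neg hm', if_neg hm]
        by_cases h1 : G.Adj j v
        · rw [if_pos h1, if_neg (hnotboth j hj hm h1), if_pos h1]
          linarith
        · rw [if_neg h1]
          split_ifs <;> linarith
    have hs := Finset.sum_le_sum key
    rw [Finset.sum_add_distrib, hσ.sum_eq g, hσ.sum_ite] at hs
    change ∑ j ∈ nb G u, g j ≤ _
    rw [hyw, ← hcardR]
    linarith
  · -- rows of the neighbours
    have hsub : nb G v ⊆ insert u ((if G.Adj v w then {w} else ∅) ∪
        (if σ v = v then ∅ else {σ v})) := by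
      intro j hj
      rw [mem_nb] at hj
      rw [mem_insert, mem_union]
      rcases hnvu j with rfl | rfl | h
      · exact Or.inl rfl
      · right; left; rw [if_pos hj]; exact mem_singleton_self _
      · right; right
        have := hσ.uniq v j hv h hj
        rw [if_neg (by rw [this]; exact hj.ne'), this]
        exact mem_singleton_self _
    have hvu : v ≠ u := hv.ne'
    have hvw : v ≠ w := fun h => hnadj (h ▸ hv)
    have hσu : σ v ≠ u := (hσ.mem v hv).ne'
    have hσw : σ v ≠ w := fun h => hnadj (h ▸ hσ.mem v hv)
    refine le_trans (Finset.sum_le_sum_of_subset_of_nonneg hsub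
      (fun j _ _ => (add_pos (hypos v) (hypos j)).le)) ?_
    rw [hyv v hv]
    by_cases hm : σ v = v
    · by_cases h1 : G.Adj v w
      · simp only [hm, h1, if_true, union_empty]
        rw [Finset.sum_pair hwu.symm, hyu, hyw, ← hcardR]
        linarith
      · simp only [hm, h1, if_true, if_false, union_empty]
        rw [Finset.sum_insert (by simp), hyu, ← hcardR, Finset.sum_empty]
        linarith
    · have hyσ := hyv _ (hσ.mem v hv)
      rw [hσ.invol, if_neg (fun h => hm h.symm)] at hyσ
      by_cases h1 : G.Adj v w
      · simp only [hm, h1, if_true, if_false]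
        rw [Finset.sum_insert (by simp [hwu.symm, hσu.symm]), 
          Finset.sum_union (by simp [hσw.symm]), Finset.sum_singleton,
          Finset.sum_singleton, hyu, hyw, hyσ, if_neg (hnotboth v hv hm h1), ← hcardR]
        linarith
      · simp only [hm, h1, if_false, empty_union]
        rw [Finset.sum_pair hσu.symm, hyu, hyσ, ← hcardR]
        split_ifs <;> linarith

theorem adj_iff_of_universal {n : ℕ} {G : SimpleGraph (Fin n)} {u : Fin n}
    {σ : Equiv.Perm (Fin n)} (hσ : Partner G u σ) (hu : ∀ v, v ≠ u → G.Adj u v) (v w : Fin n) :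
    G.Adj v w ↔ v ≠ w ∧ (v = u ∨ w = u ∨ σ v = w) := by
  constructor
  · intro h
    refine ⟨h.ne, ?_⟩
    by_cases h1 : v = u
    · exact Or.inl h1
    by_cases h2 : w = u
    · exact Or.inr (Or.inl h2)
    exact Or.inr (Or.inr (hσ.uniq v w (hu v h1) (hu w h2) h))
  · rintro ⟨hne, rfl | rfl | rfl⟩
    · exact hu w hne.symm
    · exact (hu v hne).symm
    · exact hσ.adj v hne.symm

theorem iso_of_universal {n : ℕ} {G F : SimpleGraph (Fin n)} {u u' : Fin n}
    {σ σ' : Equiv.Perm (Fin n)} (hσ : Partner G u σ) (hu : ∀ v, v ≠ u → G.Adj u v)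
    (hσ' : Partner F u' σ') (hu' : ∀ v, v ≠ u' → F.Adj u' v)
    (hcard : #σ.support = #σ'.support) : Nonempty (G ≃g F) := by
  have two : ∀ (τ : Equiv.Perm (Fin n)), (∀ v, τ (τ v) = v) →
      τ.cycleType = Multiset.replicate (#τ.support / 2) 2 := by
    intro τ h
    have h2 : τ ^ 2 = 1 := by ext v; simp [pow_two, h]
    have : Fact (Nat.Prime 2) := ⟨Nat.prime_two⟩
    have h3 := Equiv.Perm.cycleType_of_pow_prime_eq_one h2
    have h4 := τ.sum_cycleType
    rw [h3, Multiset.sum_replicate, smul_eq_mul] at h4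
    rw [← h4, Nat.mul_div_cancel _ (by norm_num)]
    exact h3
  have hconj : IsConj σ σ' := by
    rw [Equiv.Perm.isConj_iff_cycleType_eq, two σ hσ.invol, two σ' hσ'.invol, hcard]
  obtain ⟨c, hc⟩ := isConj_iff.1 hconj
  have hc' : ∀ v, σ' (c v) = c (σ v) := by
    intro v
    rw [← hc]; simp
  have fu : σ u = u := hσ.out u (G.irrefl)
  have fu' : σ' u' = u' := hσ'.out u' (F.irrefl)
  have fx : σ (c.symm u') = c.symm u' := by
    apply c.injective
    rw [← hc']; simp [fu']
  have hcomm : ∀ v, σ (Equiv.swap u (c.symm u') v) = Equiv.swap u (c.symm u') (σ v) := by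
    intro v
    by_cases h1 : v = u
    · subst h1; rw [fu, Equiv.swap_apply_left, fx]
    by_cases h2 : v = c.symm u'
    · rw [h2, fx, Equiv.swap_apply_right, fu]
    rw [Equiv.swap_apply_of_ne_of_ne h1 h2, Equiv.swap_apply_of_ne_of_ne]
    · intro h; exact h1 (σ.injective (h.trans fu.symm))
    · intro h; exact h2 (σ.injective (h.trans fx.symm))
  let τ : Equiv.Perm (Fin n) := (Equiv.swap u (c.symm u')).trans c
  have hτu : τ u = u' := by simp [τ]
  have hτσ : ∀ v, σ' (τ v) = τ (σ v) := by
    intro v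
    simp only [τ, Equiv.trans_apply]
    rw [hc', hcomm]
  refine ⟨⟨τ, ?_⟩⟩
  intro v w
  rw [adj_iff_of_universal hσ hu, adj_iff_of_universal hσ' hu', hτσ, ← hτu]
  simp only [ne_eq, τ.injective.eq_iff]

/-- The centre row of the quotient equation for a dominated matching. -/
noncomputable def hub (n M : ℕ) (x : ℝ) : ℝ :=
  ((n : ℝ) - 1) + (M / (x - 3) + ((n : ℝ) - 1 - M) / (x - 1))

theorem universal_rows {n : ℕ} (hn : 6 ≤ n) {G : SimpleGraph (Fin n)} {u : Fin n}
    {σ : Equiv.Perm (Fin n)} (hσ : Partner G u σ) (hu : ∀ v, v ≠ u → G.Adj u v)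
    (x : ℝ) (hx : 3 < x) :
    ∃ y : Fin n → ℝ, (∀ v, 0 < y v) ∧ y u = 1 ∧
      (∑ j ∈ nb G u, (y u + y j) = hub n (#σ.support) x) ∧
      ∀ v, v ≠ u → ∑ j ∈ nb G v, (y v + y j) = x * y v := by
  have h3 : 0 < x - 3 := by linarith
  have h1 : 0 < x - 1 := by linarith
  let y : Fin n → ℝ := fun v => if v = u then 1 else if σ v = v then 1 / (x - 1) else 1 / (x - 3)
  have hyu : y u = 1 := by simp [y]
  have hyv : ∀ v, v ≠ u → y v = if σ v = v then 1 / (x - 1) else 1 / (x - 3) := by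
    intro v hv; simp [y, hv]
  have hnb : nb G u = {u}ᶜ := by
    ext v
    simp only [mem_nb, mem_compl, mem_singleton]
    exact ⟨fun h => h.ne', hu v⟩
  have hcard : #(nb G u) + 1 = n := by
    rw [hnb, Finset.card_compl, Finset.card_singleton, Fintype.card_fin]; omega
  have hcardR : (#(nb G u) : ℝ) = n - 1 := by
    have h : (#(nb G u) : ℝ) + 1 = n := by exact_mod_cast hcard
    linarith
  refine ⟨y, ?_, hyu, ?_, ?_⟩
  · intro v
    simp only [y]
    split_ifs <;> positivity
  · rw [Finset.sum_add_distrib, Finset.sum_const, nsmul_eq_mul, hyu]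
    have : ∑ j ∈ nb G u, y j = ∑ j ∈ nb G u, if σ j = j then 1 / (x - 1) else 1 / (x - 3) := by
      apply Finset.sum_congr rfl
      intro j hj
      rw [mem_nb] at hj
      exact hyv j hj.ne'
    rw [this, hσ.sum_ite, hcardR, hub]
    ring
  · intro v hv
    by_cases hm : σ v = v
    · have : nb G v = {u} := by
        ext j
        rw [mem_nb, mem_singleton, adj_iff_of_universal hσ hu, hm]
        constructor
        · rintro ⟨ha, hb | hb | hb⟩
          · exact absurd hb hv
          · exact hb
          · exact absurd hb ha
        · rintro rfl; exact ⟨hv, Or.inr (Or.inl rfl)⟩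
      rw [this, Finset.sum_singleton, hyu, hyv v hv, if_pos hm]
      field_simp; ring
    · have hσu : σ v ≠ u := (hσ.mem v (hu v hv)).ne'
      have : nb G v = {u, σ v} := by
        ext j
        rw [mem_nb, mem_insert, mem_singleton, adj_iff_of_universal hσ hu]
        constructor
        · rintro ⟨ha, hb | hb | hb⟩
          · exact absurd hb hv
          · exact Or.inl hb
          · exact Or.inr hb.symm
        · rintro (rfl | rfl)
          · exact ⟨hv, Or.inr (Or.inl rfl)⟩
          · exact ⟨fun h => hm h.symm, Or.inr (Or.inr rfl)⟩
      rw [this, Finset.sum_pair hσu.symm, hyu, hyv v hv, hyv _ hσu, hσ.invol, if_neg hm,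
        if_neg (fun h => hm h.symm)]
      field_simp; ring

theorem universal_le {n : ℕ} (hn : 6 ≤ n) {G : SimpleGraph (Fin n)} {u : Fin n}
    {σ : Equiv.Perm (Fin n)} (hσ : Partner G u σ) (hu : ∀ v, v ≠ u → G.Adj u v)
    (x : ℝ) (hx : 3 < x) (h : hub n (#σ.support) x ≤ x) : qrad G ≤ x := by
  obtain ⟨y, hy, hyu, hr, hr'⟩ := universal_rows hn hσ hu x hx
  apply qrad_le G y hy x (by linarith)
  intro v
  by_cases hv : v = u
  · rw [hv, hr, hyu]; linarith
  · exact (hr' v hv).le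

theorem universal_eq {n : ℕ} (hn : 6 ≤ n) {G : SimpleGraph (Fin n)} {u : Fin n}
    {σ : Equiv.Perm (Fin n)} (hσ : Partner G u σ) (hu : ∀ v, v ≠ u → G.Adj u v)
    (x : ℝ) (hx : 3 < x) (h : hub n (#σ.support) x = x) : qrad G = x := by
  obtain ⟨y, hy, hyu, hr, hr'⟩ := universal_rows hn hσ hu x hx
  apply qrad_eq (by omega) G y hy x (by linarith)
  intro v
  by_cases hv : v = u
  · rw [hv, hr, hyu]; linarith
  · exact hr' v hv

theorem hub_continuousAt (n M : ℕ) (x : ℝ) (hx : 3 < x) : ContinuousAt (hub n M) x := by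
  unfold hub
  have h3 : x - 3 ≠ 0 := by linarith
  have h1 : x - 1 ≠ 0 := by linarith
  fun_prop (disch := assumption)

theorem hub_root {n M : ℕ} (hn : 6 ≤ n) (hM : n ≤ M + 2) (hM' : M + 1 ≤ n) :
    ∃ x : ℝ, (n : ℝ) < x ∧ hub n M x = x := by
  have hnR : (6 : ℝ) ≤ n := by exact_mod_cast hn
  have hMR : (n : ℝ) ≤ M + 2 := by exact_mod_cast hM
  have hMR' : (M : ℝ) + 1 ≤ n := by exact_mod_cast hM'
  have hcont : ContinuousOn (fun x => x - hub n M x) (Set.Icc (n : ℝ) (n + 3)) := by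
    intro x hx
    exact (continuousAt_id.sub (hub_continuousAt n M x (by linarith [hx.1]))).continuousWithinAt
  have hlow : (n : ℝ) - hub n M n < 0 := by
    have h1 : 1 < (M : ℝ) / (n - 3) := by rw [lt_div_iff₀ (by linarith)]; linarith
    have h2 : 0 ≤ ((n : ℝ) - 1 - M) / (n - 1) := div_nonneg (by linarith) (by linarith)
    unfold hub
    linarith
  have hhigh : 0 < (n + 3 : ℝ) - hub n M (n + 3) := by
    have h1 : (M : ℝ) / (n + 3 - 3) ≤ 1 := by rw [div_le_iff₀ (by linarith)]; linarith
    have h2 : ((n : ℝ) - 1 - M) / (n + 3 - 1) ≤ 1 := by rw [div_le_iff₀ (by linarith)]; linarith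
    unfold hub
    linarith
  obtain ⟨x, hx, hx0⟩ := intermediate_value_Icc (by linarith : (n : ℝ) ≤ n + 3) hcont
    ⟨hlow.le, hhigh.le⟩
  refine ⟨x, lt_of_le_of_ne hx.1 ?_, by simp only at hx0; linarith⟩
  rintro rfl
  simp only at hx0
  linarith

theorem hub_strict {n M M' : ℕ} (hlt : M' < M) (x : ℝ) (hx : 3 < x) (h : hub n M x = x) :
    ∃ c, 3 < c ∧ c < x ∧ hub n M' c ≤ c := by
  have h3 : 0 < x - 3 := by linarith
  have h1 : 0 < x - 1 := by linarith
  have hl : hub n M' x < x := by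
    have hMM : (0 : ℝ) < M - M' := by
      have : (M' : ℝ) < M := by exact_mod_cast hlt
      linarith
    have e : x - hub n M' x = ((M : ℝ) - M') * (1 / (x - 3) - 1 / (x - 1)) := by
      have : x - hub n M' x = hub n M x - hub n M' x := by rw [h]
      rw [this]
      unfold hub
      ring
    have hp : 0 < 1 / (x - 3) - 1 / (x - 1) := by
      rw [sub_pos]
      exact one_div_lt_one_div_of_lt h3 (by linarith)
    have := mul_pos hMM hp
    linarith
  have ev1 := (hub_continuousAt n M' x hx).eventually_lt continuousAt_id hl
  have ev2 : ∀ᶠ c in nhds x, 3 < c := lt_mem_nhds hx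
  have ev := ((ev1.and ev2).filter_mono (nhdsWithin_le_nhds (s := Set.Iio x))).and
    self_mem_nhdsWithin
  obtain ⟨c, ⟨hc1, hc2⟩, hc3⟩ := ev.exists
  exact ⟨c, hc2, hc3, le_of_lt hc1⟩

theorem friendship_facts {n : ℕ} (hn : 6 ≤ n) :
    ∃ (u : Fin n) (σ : Equiv.Perm (Fin n)), Partner (friendship n) u σ ∧
      (∀ v, v ≠ u → (friendship n).Adj u v) ∧ n ≤ #σ.support + 2 := by
  have hu : ∀ v : Fin n, v ≠ ⟨0, by omega⟩ → (friendship n).Adj ⟨0, by omega⟩ v := by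
    intro v hv
    simp only [friendship, SimpleGraph.fromRel_adj]
    exact ⟨hv.symm, by simp⟩
  obtain ⟨σ, hσ⟩ := exists_partner (friendship n) ⟨0, by omega⟩ (by
    intro v w w' h1 h2 h3 h4 h5
    simp only [friendship, SimpleGraph.fromRel_adj, ne_eq, Fin.ext_iff] at h1 h2 h3 h4 h5
    ext
    omega)
  refine ⟨_, σ, hσ, hu, ?_⟩
  have hsub : ({⟨0, by omega⟩, ⟨n - 1, by omega⟩} : Finset (Fin n))ᶜ ⊆ σ.support := by
    intro v hv
    simp only [mem_compl, mem_insert, mem_singleton, not_or, Fin.ext_iff] at hv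
    obtain ⟨w, hw0, hvw, hw⟩ : ∃ w : Fin n, w.val ≠ 0 ∧ v ≠ w ∧
        (v.val + 1) / 2 = (w.val + 1) / 2 := by
      rcases Nat.mod_two_eq_zero_or_one v.val with h | h
      · exact ⟨⟨v.val - 1, by omega⟩, by simp only; omega, by
          simp only [ne_eq, Fin.ext_iff]; omega, by simp only; omega⟩
      · exact ⟨⟨v.val + 1, by omega⟩, by simp only; omega, by
          simp only [ne_eq, Fin.ext_iff]; omega, by simp only; omega⟩
    rw [Equiv.Perm.mem_support]
    have hadj : (friendship n).Adj v w := by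
      simp only [friendship, SimpleGraph.fromRel_adj]
      exact ⟨hvw, Or.inl (Or.inr hw)⟩
    rw [hσ.uniq v w (hu v (by simp only [ne_eq, Fin.ext_iff]; exact hv.1))
      (hu w (by simp only [ne_eq, Fin.ext_iff]; exact hw0)) hadj]
    exact hvw.symm
  have h := Finset.card_le_card hsub
  rw [Finset.card_compl, Fintype.card_fin] at h
  have := Finset.card_le_two (a := (⟨0, by omega⟩ : Fin n)) (b := ⟨n - 1, by omega⟩)
  omega

theorem support_lt {n : ℕ} {G : SimpleGraph (Fin n)} {u : Fin n}
    {σ : Equiv.Perm (Fin n)} (hσ : Partner G u σ) : #σ.support + 1 ≤ n := by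
  have hsub : σ.support ⊆ {u}ᶜ := by
    intro v hv
    rw [mem_compl, mem_singleton]
    rintro rfl
    exact (Equiv.Perm.mem_support.1 hv) (hσ.out v G.irrefl)
  have h := Finset.card_le_card hsub
  rw [Finset.card_compl, Fintype.card_fin, Finset.card_singleton] at h
  have := u.isLt
  omega

/-- If `G` is a θ(1,2,2)-free graph on `n ≥ 6` vertices, then
`q(G) ≤ q(Fₙ)`, with equality only if `G ≅ Fₙ`. -/
theorem stmt0 (n : ℕ) (hn : 6 ≤ n) (G : SimpleGraph (Fin n))
    (hfree : ¬ contains theta122 G) :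
    qrad G ≤ qrad (friendship n) ∧
      (qrad G = qrad (friendship n) → Nonempty (G ≃g friendship n)) := by
  classical
  obtain ⟨u', σ', hσ', hu', hM'⟩ := friendship_facts hn
  obtain ⟨x, hx, hroot⟩ := hub_root hn hM' (support_lt hσ')
  have hx3 : 3 < x := by
    have : (6 : ℝ) ≤ n := by exact_mod_cast hn
    linarith
  have hF : qrad (friendship n) = x := universal_eq hn hσ' hu' x hx3 hroot
  rw [hF]
  by_cases hU : ∃ u, ∀ v, v ≠ u → G.Adj u v
  · obtain ⟨u, hu⟩ := hU
    obtain ⟨σ, hσ⟩ := exists_partner G u (fun v w w' h1 h2 h3 h4 h5 =>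
      no_diamond G hfree h1 h2 h4 h3 h5)
    have e1 := hσ.even
    have e2 := hσ'.even
    have l1 := support_lt hσ
    have l2 := support_lt hσ'
    rcases (by omega : #σ.support < #σ'.support ∨ #σ.support = #σ'.support) with hlt | heq
    · obtain ⟨c, hc3, hcx, hc⟩ := hub_strict hlt x hx3 hroot
      have := universal_le hn hσ hu c hc3 hc
      exact ⟨by linarith, fun h => by linarith⟩
    · refine ⟨universal_le hn hσ hu x hx3 (by rw [heq, hroot]), fun _ => ?_⟩
      exact iso_of_universal hσ hu hσ' hu' heq
  · suffices hq : qrad G ≤ n from ⟨by linarith, fun h => by linarith⟩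
    by_cases hB : ∃ u w, w ≠ u ∧ ¬ G.Adj u w ∧ ∀ v, v ≠ u → v ≠ w → G.Adj u v
    · obtain ⟨u, w, h1, h2, h3⟩ := hB
      exact caseB hn G hfree u w h1 h2 h3
    · apply caseA G hfree
      intro i
      push Not at hU hB
      obtain ⟨w, hw1, hw2⟩ := hU i
      obtain ⟨z, hz1, hz2, hz3⟩ := hB i w hw1 hw2
      have hsub : nb G i ⊆ {i, w, z}ᶜ := by
        intro v hv
        rw [mem_nb] at hv
        simp only [mem_compl, mem_insert, mem_singleton, not_or]
        exact ⟨hv.ne', fun h => hw2 (h ▸ hv), fun h => hz3 (h ▸ hv)⟩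
      have h := Finset.card_le_card hsub
      have h3 : #({i, w, z} : Finset (Fin n)) = 3 :=
        Finset.card_eq_three.2 ⟨i, w, z, hw1.symm, hz1.symm, hz2.symm, rfl⟩
      rw [Finset.card_compl, Fintype.card_fin, h3] at h
      omega
end

section
/- Let G be a simple graph on n ≥ 6 vertices that is θ(1,2,3)-free. Then the signless Laplacian spectral radius satisfies q(G) ≤ q(S_{n,2}), with equality only if G is isomorphic to S_{n,2}. -/
open SimpleGraph Finset

lemma root_vec {n : ℕ} (M : Matrix (Fin n) (Fin n) ℝ) (μ : ℝ) :
    M.charpoly.IsRoot μ ↔ ∃ z : Fin n → ℝ, z ≠ 0 ∧ ∀ i, ∑ j, M i j * z j = μ * z i := by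
  rw [Polynomial.IsRoot.def, Matrix.eval_charpoly, ← Matrix.exists_mulVec_eq_zero_iff]
  refine exists_congr fun z => and_congr_right fun _ => ?_
  rw [funext_iff]
  refine forall_congr' fun i => ?_
  rw [Matrix.sub_mulVec]
  simp only [Pi.sub_apply, Pi.zero_apply, Matrix.scalar_apply, Matrix.mulVec_diagonal]
  rw [sub_eq_zero, eq_comm]
  rfl

lemma row_eq {n : ℕ} (G : SimpleGraph (Fin n)) [DecidableRel G.Adj] (z : Fin n → ℝ) (i : Fin n) :
    ∑ j, (G.degMatrix ℝ + G.adjMatrix ℝ) i j * z j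
      = (G.degree i : ℝ) * z i + ∑ j ∈ G.neighborFinset i, z j := by
  simp only [Matrix.add_apply, add_mul, Finset.sum_add_distrib]
  congr 1
  · simp [SimpleGraph.degMatrix, Matrix.diagonal_apply]
  · simp [SimpleGraph.adjMatrix_apply, SimpleGraph.neighborFinset_eq_filter, Finset.sum_filter]

lemma qrad_eq_s1 {n : ℕ} (G : SimpleGraph (Fin n)) [DecidableRel G.Adj] :
    qrad G = sSup {x : ℝ | ∃ z : Fin n → ℝ, z ≠ 0 ∧
      ∀ i, (G.degree i : ℝ) * z i + ∑ j ∈ G.neighborFinset i, z j = x * z i} := by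
  unfold qrad
  simp only [root_vec, row_eq]
  congr!

lemma roots_finite {n : ℕ} (G : SimpleGraph (Fin n)) [DecidableRel G.Adj] :
    {x : ℝ | ∃ z : Fin n → ℝ, z ≠ 0 ∧
      ∀ i, (G.degree i : ℝ) * z i + ∑ j ∈ G.neighborFinset i, z j = x * z i}.Finite := by
  have := Polynomial.finite_setOfPred_isRoot
    (Matrix.charpoly_monic (G.degMatrix ℝ + G.adjMatrix ℝ)).ne_zero
  simpa only [root_vec, row_eq] using this

lemma le_qrad {n : ℕ} (G : SimpleGraph (Fin n)) [DecidableRel G.Adj] (l : ℝ) (z : Fin n → ℝ)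
    (hz : z ≠ 0)
    (h : ∀ i, (G.degree i : ℝ) * z i + ∑ j ∈ G.neighborFinset i, z j = l * z i) :
    l ≤ qrad G := by
  rw [qrad_eq_s1]
  exact le_csSup (roots_finite G).bddAbove ⟨z, hz, h⟩

/-- Maximal ratio of an eigenvector against a positive test vector. -/
lemma ratio {n : ℕ} (G : SimpleGraph (Fin n)) [DecidableRel G.Adj] (μ : ℝ) (x z : Fin n → ℝ)
    (hx : ∀ i, 0 < x i) (hz : z ≠ 0)
    (h : ∀ i, (G.degree i : ℝ) * z i + ∑ j ∈ G.neighborFinset i, z j = μ * z i) :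
    ∃ (r : Fin n → ℝ) (i : Fin n), 0 < r i ∧ (∀ j, r j ≤ r i) ∧
      ∀ j, μ * (r j * x j) ≤
        (G.degree j : ℝ) * (r j * x j) + ∑ k ∈ G.neighborFinset j, r k * x k := by
  obtain ⟨i0, hi0⟩ := Function.ne_iff.mp hz
  obtain ⟨i, -, hi⟩ := Finset.exists_max_image Finset.univ (fun j => |z j| / x j)
    ⟨i0, Finset.mem_univ _⟩
  have e : ∀ j, |z j| / x j * x j = |z j| := fun j => div_mul_cancel₀ _ (hx j).ne'
  refine ⟨fun j => |z j| / x j, i, ?_, fun j => hi j (Finset.mem_univ _), fun j => ?_⟩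
  · refine lt_of_lt_of_le ?_ (hi i0 (Finset.mem_univ _))
    exact div_pos (abs_pos.mpr hi0) (hx i0)
  · simp only [e]
    calc μ * |z j| ≤ |μ * z j| := by
          rw [abs_mul]; exact mul_le_mul_of_nonneg_right (le_abs_self _) (abs_nonneg _)
      _ = |(G.degree j : ℝ) * z j + ∑ k ∈ G.neighborFinset j, z k| := by rw [h]
      _ ≤ |(G.degree j : ℝ) * z j| + |∑ k ∈ G.neighborFinset j, z k| := abs_add_le _ _
      _ ≤ _ := by
          rw [abs_mul, Nat.abs_cast]
          gcongr
          exact Finset.abs_sum_le_sum_abs _ _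

lemma qrad_le_s1 {n : ℕ} (G : SimpleGraph (Fin n)) [DecidableRel G.Adj] (l : ℝ) (hl : 0 < l)
    (x : Fin n → ℝ) (hx : ∀ i, 0 < x i)
    (h : ∀ i, (G.degree i : ℝ) * x i + ∑ j ∈ G.neighborFinset i, x j ≤ l * x i) :
    qrad G ≤ l := by
  rw [qrad_eq_s1]
  refine Real.sSup_le ?_ hl.le
  rintro μ ⟨z, hz, hzz⟩
  obtain ⟨r, i, hi, hm, hr⟩ := ratio G μ x z hx hz hzz
  have h1 := hr i
  have h2 : ∑ k ∈ G.neighborFinset i, r k * x k ≤ r i * ∑ k ∈ G.neighborFinset i, x k := by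
    rw [Finset.mul_sum]
    exact Finset.sum_le_sum fun k _ => mul_le_mul_of_nonneg_right (hm k) (hx k).le
  have h3 := mul_le_mul_of_nonneg_left (h i) hi.le
  have h4 : μ * (r i * x i) ≤ l * (r i * x i) := by nlinarith
  exact le_of_mul_le_mul_right h4 (mul_pos hi (hx i))

lemma qrad_lt {n : ℕ} (G : SimpleGraph (Fin n)) [DecidableRel G.Adj] (l : ℝ) (hl : 0 < l)
    (x : Fin n → ℝ) (hx : ∀ i, 0 < x i)
    (h : ∀ i, (G.degree i : ℝ) * x i + ∑ j ∈ G.neighborFinset i, x j ≤ l * x i)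
    (h' : ∀ i, (G.degree i : ℝ) * x i + ∑ j ∈ G.neighborFinset i, x j < l * x i ∨
      ∃ k, G.Adj i k ∧ (G.degree k : ℝ) * x k + ∑ j ∈ G.neighborFinset k, x j < l * x k) :
    qrad G < l := by
  have key : ∀ μ ∈ {x : ℝ | ∃ z : Fin n → ℝ, z ≠ 0 ∧
      ∀ i, (G.degree i : ℝ) * z i + ∑ j ∈ G.neighborFinset i, z j = x * z i}, μ < l := by
    rintro μ ⟨z, hz, hzz⟩
    obtain ⟨r, i, hi, hm, hr⟩ := ratio G μ x z hx hz hzz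
    by_contra hlt
    push Not at hlt
    have strict : ∀ k, r k = r i →
        ¬ (G.degree k : ℝ) * x k + ∑ j ∈ G.neighborFinset k, x j < l * x k := by
      intro k hk hs
      have h1 := hr k
      have h2 : ∑ j ∈ G.neighborFinset k, r j * x j ≤ r k * ∑ j ∈ G.neighborFinset k, x j := by
        rw [Finset.mul_sum]
        exact Finset.sum_le_sum fun j _ => mul_le_mul_of_nonneg_right (hk ▸ hm j) (hx j).le
      have hk0 : 0 < r k := hk ▸ hi
      have h3 := mul_lt_mul_of_pos_left hs hk0
      have h4 : μ * (r k * x k) < l * (r k * x k) := by nlinarith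
      exact absurd (lt_of_mul_lt_mul_right h4 (mul_pos hk0 (hx k)).le) (not_lt.mpr hlt)
    rcases h' i with hs | ⟨k, hik, hs⟩
    · exact strict i rfl hs
    · have hk : r k < r i := lt_of_le_of_ne (hm k) fun e => strict k e hs
      have h1 := hr i
      have h2 : ∑ j ∈ G.neighborFinset i, r j * x j < r i * ∑ j ∈ G.neighborFinset i, x j := by
        rw [Finset.mul_sum]
        refine Finset.sum_lt_sum
          (fun j _ => mul_le_mul_of_nonneg_right (hm j) (hx j).le) ⟨k, by simpa using hik, ?_⟩
        exact mul_lt_mul_of_pos_right hk (hx k)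
      have h3 := mul_le_mul_of_nonneg_left (h i) hi.le
      have h4 : μ * (r i * x i) < l * (r i * x i) := by nlinarith
      exact absurd (lt_of_mul_lt_mul_right h4 (mul_pos hi (hx i)).le) (not_lt.mpr hlt)
  rw [qrad_eq_s1]
  rcases Set.eq_empty_or_nonempty {x : ℝ | ∃ z : Fin n → ℝ, z ≠ 0 ∧
      ∀ i, (G.degree i : ℝ) * z i + ∑ j ∈ G.neighborFinset i, z j = x * z i} with he | hne
  · rw [he, Real.sSup_empty]; exact hl
  · exact key _ (hne.csSup_mem (roots_finite G))

/-- Rows of the book graph. -/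
lemma book_row {n : ℕ} (G : SimpleGraph (Fin n)) [DecidableRel G.Adj] (u v : Fin n) (huv : u ≠ v)
    (hG : ∀ a c, G.Adj a c ↔ a ≠ c ∧ (a = u ∨ a = v ∨ c = u ∨ c = v)) (b l : ℝ)
    (h1 : l * b = 2 * b + 2) (h2 : l = n + (n - 2) * b) (i : Fin n) :
    (G.degree i : ℝ) * (if i = u ∨ i = v then 1 else b) +
      ∑ j ∈ G.neighborFinset i, (if j = u ∨ j = v then 1 else b)
      = l * (if i = u ∨ i = v then 1 else b) := by
  have hsum : ∑ j : Fin n, (if j = u ∨ j = v then (1:ℝ) else b) = 2 + (n - 2) * b := by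
    have : ∀ j : Fin n, (if j = u ∨ j = v then (1:ℝ) else b) =
        b + ((if j = u then (1 - b) else 0) + (if j = v then 1 - b else 0)) := by
      intro j
      by_cases h : j = u
      · subst h; simp [huv]
      · by_cases h' : j = v
        · have hvu : v ≠ u := huv.symm
          subst h'; simp [hvu]
        · simp [h, h']
    simp only [this, Finset.sum_add_distrib]
    simp
    ring
  by_cases hi : i = u ∨ i = v
  · have hN : G.neighborFinset i = Finset.univ.erase i := by
      ext c; simp [hG]; grind
    have hd : (G.degree i : ℝ) = n - 1 := by
      rw [← SimpleGraph.card_neighborFinset_eq_degree, hN, Finset.card_erase_of_mem (mem_univ _)]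
      have : 1 ≤ n := by have := i.2; omega
      simp [Nat.cast_sub this]
    rw [hd, hN, Finset.sum_erase_eq_sub (mem_univ _), hsum]
    simp only [hi, if_true]
    linarith
  · have hN : G.neighborFinset i = {u, v} := by
      ext c; simp [hG]; grind
    have hd : (G.degree i : ℝ) = 2 := by
      rw [← SimpleGraph.card_neighborFinset_eq_degree, hN, Finset.card_pair huv]; norm_num
    rw [hd, hN, Finset.sum_pair huv]
    simp [hi]
    linarith

/-- `H` has no path on four vertices. -/
def P4f {V : Type*} (H : SimpleGraph V) : Prop :=
  ∀ a b c d, a ≠ c → a ≠ d → b ≠ d → H.Adj a b → H.Adj b c → H.Adj c d → False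

/-- Sign of the difference of two naturals. -/
noncomputable def tau (a b : ℕ) : ℝ := (if b < a then 1 else 0) - (if a < b then 1 else 0)

lemma tau_anti (a b : ℕ) : tau a b = - tau b a := by unfold tau; ring

/-- Discharging function. -/
noncomputable def sg {n : ℕ} (H : SimpleGraph (Fin n)) [DecidableRel H.Adj] (u : Fin n) : ℝ :=
  ∑ w ∈ H.neighborFinset u, tau (H.degree u) (H.degree w)

lemma sum_sg {n : ℕ} (H : SimpleGraph (Fin n)) [DecidableRel H.Adj] : ∑ u, sg H u = 0 := by
  have h : ∑ u, sg H u = ∑ u, ∑ w, if H.Adj u w then tau (H.degree u) (H.degree w) else 0 := by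
    unfold sg
    simp [SimpleGraph.neighborFinset_eq_filter, Finset.sum_filter]
  have h2 : ∑ u, sg H u = - ∑ u, sg H u := by
    conv_lhs => rw [h, Finset.sum_comm]
    rw [h, ← Finset.sum_neg_distrib]
    refine Finset.sum_congr rfl fun u _ => ?_
    rw [← Finset.sum_neg_distrib]
    refine Finset.sum_congr rfl fun w _ => ?_
    rw [tau_anti]
    by_cases hh : H.Adj u w
    · simp [hh, hh.symm]
    · have hh' : ¬ H.Adj w u := fun h => hh h.symm
      simp [hh, hh']
  linarith

section struct
variable {n : ℕ} (H : SimpleGraph (Fin n)) [DecidableRel H.Adj]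

lemma exists_other {u w : Fin n} (h : 2 ≤ H.degree u) : ∃ a, H.Adj u a ∧ a ≠ w := by
  rw [← SimpleGraph.card_neighborFinset_eq_degree] at h
  obtain ⟨a, ha, hne⟩ := Finset.exists_mem_ne (s := H.neighborFinset u) (by omega) w
  exact ⟨a, by simpa using ha, hne⟩

lemma tri (hP : P4f H) {u w : Fin n} (huw : H.Adj u w) (hu : 2 ≤ H.degree u) (hw : 2 ≤ H.degree w) :
    H.degree u = 2 ∧ ∀ x, H.Adj u x → H.degree x = 2 := by
  obtain ⟨z, hz, hzw⟩ := exists_other H (w := w) hu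
  obtain ⟨c, hc, hcu⟩ := exists_other H (w := u) hw
  have e1 : ∀ a c, H.Adj u a → a ≠ w → H.Adj w c → c ≠ u → a = c := by
    intro a c h1 h2 h3 h4
    by_contra hne
    exact hP a u w c h2 hne h4.symm h1.symm huw h3
  have hzc := e1 z c hz hzw hc hcu
  subst hzc
  have Nu : H.neighborFinset u = {w, z} := by
    ext a; simp only [mem_neighborFinset, Finset.mem_insert, Finset.mem_singleton]
    constructor
    · intro h; by_cases ha : a = w
      · exact Or.inl ha
      · exact Or.inr (e1 a z h ha hc hcu)
    · rintro (rfl | rfl) <;> assumption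
  have Nw : H.neighborFinset w = {u, z} := by
    ext a; simp only [mem_neighborFinset, Finset.mem_insert, Finset.mem_singleton]
    constructor
    · intro h; by_cases ha : a = u
      · exact Or.inl ha
      · exact Or.inr (e1 z a hz hzw h ha).symm
    · rintro (rfl | rfl)
      · exact huw.symm
      · assumption
  have Nz : H.neighborFinset z = {u, w} := by
    ext a; simp only [mem_neighborFinset, Finset.mem_insert, Finset.mem_singleton]
    constructor
    · intro h; by_contra hne
      push Not at hne
      exact hP a z u w hne.1 hne.2 hzw h.symm hz.symm huw
    · rintro (rfl | rfl)
      · exact hz.symm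
      · exact hc.symm
  have du : H.degree u = 2 := by
    rw [← SimpleGraph.card_neighborFinset_eq_degree, Nu, Finset.card_pair hzw.symm]
  have dw : H.degree w = 2 := by
    rw [← SimpleGraph.card_neighborFinset_eq_degree, Nw, Finset.card_pair hcu.symm]
  have dz : H.degree z = 2 := by
    rw [← SimpleGraph.card_neighborFinset_eq_degree, Nz, Finset.card_pair huw.ne]
  refine ⟨du, fun x hx => ?_⟩
  have : x ∈ H.neighborFinset u := by simpa using hx
  rw [Nu] at this
  simp only [Finset.mem_insert, Finset.mem_singleton] at this
  rcases this with rfl | rfl <;> assumption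

lemma deg_pos_of_adj {u w : Fin n} (h : H.Adj u w) : 1 ≤ H.degree w :=
  (H.degree_pos_iff_exists_adj w).mpr ⟨u, h.symm⟩

lemma struct_cases (hP : P4f H) (u : Fin n) :
    (H.degree u = 0) ∨
    ((H.degree u = 1 ∨ H.degree u = 2) ∧ ∀ w, H.Adj u w → H.degree w = H.degree u) ∨
    (2 ≤ H.degree u ∧ ∀ w, H.Adj u w → H.degree w = 1) ∨
    (H.degree u = 1 ∧ ∃ w, H.neighborFinset u = {w} ∧ 2 ≤ H.degree w ∧
      ∀ x, H.Adj w x → H.degree x = 1) := by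
  rcases Nat.lt_or_ge (H.degree u) 2 with hu | hu
  · rcases Nat.eq_zero_or_pos (H.degree u) with h0 | h0
    · exact Or.inl h0
    · have h1 : H.degree u = 1 := by omega
      have h1' := h1
      rw [← SimpleGraph.card_neighborFinset_eq_degree, Finset.card_eq_one] at h1'
      obtain ⟨w, hw⟩ := h1'
      have huw : H.Adj u w := by
        have : w ∈ H.neighborFinset u := by rw [hw]; simp
        simpa using this
      have hdw := deg_pos_of_adj H huw
      rcases Nat.lt_or_ge (H.degree w) 2 with h2 | h2
      · refine Or.inr (Or.inl ⟨Or.inl h1, fun x hx => ?_⟩)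
        have : x ∈ H.neighborFinset u := by simpa using hx
        rw [hw, Finset.mem_singleton] at this
        subst this; omega
      · refine Or.inr (Or.inr (Or.inr ⟨h1, w, hw, h2, fun x hx => ?_⟩))
        have hdx := deg_pos_of_adj H hx
        by_contra hne
        have := (tri H hP hx h2 (by omega)).2 u huw.symm
        omega
  · by_cases hall : ∀ w, H.Adj u w → H.degree w = 1
    · exact Or.inr (Or.inr (Or.inl ⟨hu, hall⟩))
    · push Not at hall
      obtain ⟨w, huw, hw⟩ := hall
      have hdw := deg_pos_of_adj H huw
      obtain ⟨e, f⟩ := tri H hP huw hu (by omega)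
      exact Or.inr (Or.inl ⟨Or.inr e, fun x hx => by rw [f x hx, e]⟩)

lemma sg_zero {u : Fin n} (h : ∀ w, H.Adj u w → H.degree w = H.degree u) : sg H u = 0 := by
  unfold sg
  refine Finset.sum_eq_zero fun w hw => ?_
  rw [h w (by simpa using hw)]; simp [tau]

lemma sg_center {u : Fin n} (h2 : 2 ≤ H.degree u) (h : ∀ w, H.Adj u w → H.degree w = 1) :
    sg H u = H.degree u := by
  unfold sg
  have : ∀ w ∈ H.neighborFinset u, tau (H.degree u) (H.degree w) = 1 := by
    intro w hw
    rw [h w (by simpa using hw)]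
    have : 1 < H.degree u := by omega
    simp [tau, this, show H.degree u ≠ 0 by omega]
  rw [Finset.sum_congr rfl this]; simp

lemma sg_leaf {u w : Fin n} (h1 : H.degree u = 1) (hw : H.neighborFinset u = {w})
    (h2 : 2 ≤ H.degree w) : sg H u = -1 := by
  unfold sg
  rw [hw, Finset.sum_singleton, h1]
  simp [tau]
  have : 1 < H.degree w := by omega
  have h' : H.degree w ≠ 0 := by omega
  simp [this, h']

/-- pointwise discharging bound -/
lemma discharge (hP : P4f H) (u : Fin n) :
    (H.degree u : ℝ) - sg H u ≤ if H.degree u = 0 then 0 else 2 := by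
  rcases struct_cases H hP u with h | ⟨h, h'⟩ | ⟨h, h'⟩ | ⟨h, w, hw, h2, h3⟩
  · have : sg H u = 0 := by
      unfold sg
      rw [Finset.card_eq_zero.mp ((H.card_neighborFinset_eq_degree u).trans h)]; simp
    simp [h, this]
  · rw [sg_zero H h']
    rcases h with h | h <;> simp [h]
  · rw [sg_center H h h']
    simp; split_ifs <;> norm_num
  · rw [sg_leaf H h hw h2]
    simp [h]; norm_num

lemma sum_deg_le (hP : P4f H) : (∑ u, (H.degree u : ℝ)) ≤ 2 * #{u | H.degree u ≠ 0} := by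
  have h : ∑ u, ((H.degree u : ℝ) - sg H u) ≤ ∑ u, if H.degree u = 0 then (0:ℝ) else 2 :=
    Finset.sum_le_sum fun u _ => discharge H hP u
  rw [Finset.sum_sub_distrib, sum_sg] at h
  have e : (∑ u, if H.degree u = 0 then (0:ℝ) else 2) = 2 * #{u | H.degree u ≠ 0} := by
    rw [Finset.sum_ite]; simp; ring
  linarith

lemma sum_deg_le' (hP : P4f H) {a c : Fin n} (hac : H.Adj a c) (ha : H.degree a = 1) (hc : H.degree c = 1) :
    (∑ u, (H.degree u : ℝ)) + 1 ≤ 2 * #{u | H.degree u ≠ 0} := by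
  have h : 1 ≤ ∑ u, ((if H.degree u = 0 then (0:ℝ) else 2) - ((H.degree u : ℝ) - sg H u)) := by
    refine le_trans ?_ (Finset.single_le_sum (a := a)
      (fun u _ => sub_nonneg.mpr (discharge H hP u)) (Finset.mem_univ _))
    have : sg H a = 0 := by
      apply sg_zero
      obtain ⟨w, hw⟩ := Finset.card_eq_one.mp ((H.card_neighborFinset_eq_degree a).trans ha)
      have hcw : c ∈ H.neighborFinset a := by simpa using hac
      rw [hw, Finset.mem_singleton] at hcw
      subst hcw
      intro x hx
      have hxw : x ∈ H.neighborFinset a := by simpa using hx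
      rw [hw, Finset.mem_singleton] at hxw
      rw [hxw, ha, hc]
    rw [this]; simp [ha]; norm_num
  rw [Finset.sum_sub_distrib, Finset.sum_sub_distrib, sum_sg] at h
  have e : (∑ u, if H.degree u = 0 then (0:ℝ) else 2) = 2 * #{u | H.degree u ≠ 0} := by
    rw [Finset.sum_ite]; simp; ring
  linarith

end struct

lemma no_theta {n : ℕ} {G : SimpleGraph (Fin n)} (hfree : ¬ contains theta123 G)
    {v a b c w : Fin n} (hva : G.Adj v a) (hvb : G.Adj v b) (hba : G.Adj b a) (hvc : G.Adj v c)
    (hcw : G.Adj c w) (hwa : G.Adj w a) (h1 : v ≠ w) (h2 : a ≠ c) (h3 : b ≠ c) (h4 : b ≠ w) :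
    False := by
  apply hfree
  refine ⟨![v, a, b, c, w], ?_, ?_⟩
  · intro i j hij
    have e1 := hva.ne
    have e2 := hvb.ne
    have e3 := hba.ne
    have e4 := hvc.ne
    have e5 := hcw.ne
    have e6 := hwa.ne
    fin_cases i <;> fin_cases j <;> simp at hij ⊢ <;> grind
  · intro i j hij
    have e1 := hva.symm
    have e2 := hvb.symm
    have e3 := hba.symm
    have e4 := hvc.symm
    have e5 := hcw.symm
    have e6 := hwa.symm
    fin_cases i <;> fin_cases j <;> first | (simp; assumption) | (exfalso; revert hij; simp [theta123])

/-- The link of a vertex. -/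
def link {n : ℕ} (G : SimpleGraph (Fin n)) (v : Fin n) : SimpleGraph (Fin n) where
  Adj a b := G.Adj v a ∧ G.Adj v b ∧ G.Adj a b
  symm := ⟨fun _ _ h => ⟨h.2.1, h.1, h.2.2.symm⟩⟩
  loopless := ⟨fun _ h => h.2.2.ne rfl⟩

lemma link_adj {n : ℕ} (G : SimpleGraph (Fin n)) (v a b : Fin n) :
    (link G v).Adj a b ↔ G.Adj v a ∧ G.Adj v b ∧ G.Adj a b := Iff.rfl

lemma link_P4f {n : ℕ} {G : SimpleGraph (Fin n)} (hfree : ¬ contains theta123 G) (v : Fin n) :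
    P4f (link G v) := by
  intro a b c d hac had hbd h1 h2 h3
  exact no_theta hfree (v := v) (a := b) (b := a) (c := d) (w := c)
    h1.2.1 h1.1 h1.2.2 h3.2.1 h3.2.2.symm h2.2.2.symm h2.2.1.ne hbd had hac

section nondom
variable {n : ℕ} {G : SimpleGraph (Fin n)} [DecidableRel G.Adj]
  (v : Fin n) [DecidableRel (link G v).Adj]

lemma outside (hfree : ¬ contains theta123 G) (w : Fin n) (hvw : v ≠ w) (hw : ¬ G.Adj v w) :
    #(G.neighborFinset w ∩ G.neighborFinset v) ≤ 1 ∨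
    #(G.neighborFinset w ∩ G.neighborFinset v) ≤
      G.degree v - #{u | (link G v).degree u ≠ 0} ∨
    (#(G.neighborFinset w ∩ G.neighborFinset v) ≤ 2 ∧
      ∃ a c, (link G v).Adj a c ∧ (link G v).degree a = 1 ∧ (link G v).degree c = 1) := by
  set C := G.neighborFinset w ∩ G.neighborFinset v with hC
  have memC : ∀ x, x ∈ C ↔ G.Adj w x ∧ G.Adj v x := by intro x; simp [hC]
  by_cases hsub : ∀ x ∈ C, (link G v).degree x = 0
  · right; left
    have hT : ({u | (link G v).degree u ≠ 0} : Finset (Fin n)) ⊆ G.neighborFinset v := by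
      intro u hu
      simp only [Finset.mem_filter, Finset.mem_univ, true_and] at hu
      obtain ⟨x, hx⟩ := ((link G v).degree_pos_iff_exists_adj u).mp (Nat.pos_of_ne_zero hu)
      simpa using hx.1
    rw [← SimpleGraph.card_neighborFinset_eq_degree, ← Finset.card_sdiff_of_subset hT]
    apply Finset.card_le_card
    intro x hx
    have := hsub x hx
    simp [this, ((memC x).mp hx).2]
  · push Not at hsub
    obtain ⟨a, haC, ha⟩ := hsub
    by_cases h1 : #C ≤ 1
    · exact Or.inl h1
    right; right
    have key : ∀ a ∈ C, ∀ c ∈ C, a ≠ c → ∀ b, (link G v).Adj a b → b = c := by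
      intro a ha c hc hac b hab
      by_contra hbc
      obtain ⟨wa, va⟩ := (memC a).mp ha
      obtain ⟨wc, vc⟩ := (memC c).mp hc
      refine no_theta hfree (v := v) (a := a) (b := b) (c := c) (w := w) va hab.2.1
        hab.2.2.symm vc wc.symm wa hvw hac hbc ?_
      rintro rfl
      exact hw hab.2.1
    obtain ⟨b, hab⟩ := ((link G v).degree_pos_iff_exists_adj a).mp (Nat.pos_of_ne_zero ha)
    have hCb : ∀ c ∈ C, c ≠ a → c = b := fun c hc hca => (key a haC c hc hca.symm b hab).symm
    obtain ⟨c, hcC, hca⟩ := Finset.exists_mem_ne (s := C) (by omega) a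
    have hcb := hCb c hcC hca
    subst hcb
    refine ⟨?_, a, c, hab, ?_, ?_⟩
    · have : C ⊆ {a, c} := by
        intro x hx
        by_cases hxa : x = a
        · simp [hxa]
        · simp [hCb x hx hxa]
      exact (Finset.card_le_card this).trans Finset.card_le_two
    · rw [← SimpleGraph.card_neighborFinset_eq_degree, Finset.card_eq_one]
      refine ⟨c, ?_⟩
      ext x
      simp only [mem_neighborFinset, Finset.mem_singleton]
      exact ⟨fun h => key a haC c hcC hca.symm x h, by rintro rfl; exact hab⟩
    · rw [← SimpleGraph.card_neighborFinset_eq_degree, Finset.card_eq_one]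
      refine ⟨a, ?_⟩
      ext x
      simp only [mem_neighborFinset, Finset.mem_singleton]
      exact ⟨fun h => key c hcC a haC hca x h, by rintro rfl; exact hab.symm⟩

lemma link_degree (x : Fin n) (hx : G.Adj v x) :
    (link G v).degree x = #(G.neighborFinset x ∩ G.neighborFinset v) := by
  rw [← SimpleGraph.card_neighborFinset_eq_degree]
  congr 1
  ext y
  simp [link_adj, hx, and_comm]

lemma link_degree_zero (x : Fin n) (hx : ¬ G.Adj v x) : (link G v).degree x = 0 := by
  rw [← SimpleGraph.card_neighborFinset_eq_degree, Finset.card_eq_zero]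
  ext y
  simp [link_adj, hx]

lemma S_eq : ∑ u ∈ G.neighborFinset v, (G.degree u : ℝ) = G.degree v +
    ∑ u, ((link G v).degree u : ℝ) + ∑ w ∈ univ.filter (fun w => v ≠ w ∧ ¬ G.Adj v w),
      (#(G.neighborFinset w ∩ G.neighborFinset v) : ℝ) := by
  have h1 : ∑ u ∈ G.neighborFinset v, (G.degree u : ℝ) =
      ∑ x, (#(G.neighborFinset x ∩ G.neighborFinset v) : ℝ) := by
    have e1 : ∀ u, (G.degree u : ℝ) = ∑ x, if G.Adj x u then (1:ℝ) else 0 := by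
      intro u
      rw [← SimpleGraph.card_neighborFinset_eq_degree, SimpleGraph.neighborFinset_eq_filter]
      simp [G.adj_comm]
    have e2 : ∀ x, (#(G.neighborFinset x ∩ G.neighborFinset v) : ℝ) =
        ∑ u ∈ G.neighborFinset v, if G.Adj x u then (1:ℝ) else 0 := by
      intro x
      rw [Finset.sum_boole]
      congr 2
      ext u; simp [and_comm]
    simp only [e1, e2]
    rw [Finset.sum_comm]
  rw [h1, Finset.sum_filter]
  have e : (G.degree v : ℝ) = ∑ x : Fin n, if x = v then (G.degree v : ℝ) else 0 := by simp
  rw [e, ← Finset.sum_add_distrib, ← Finset.sum_add_distrib]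
  refine Finset.sum_congr rfl fun x _ => ?_
  by_cases hxv : x = v
  · subst hxv
    simp [link_degree_zero]
  · by_cases hx : G.Adj v x
    · simp [hxv, hx, link_degree]
    · simp [hxv, hx, link_degree_zero, Ne.symm hxv]

lemma card_W : (#(univ.filter (fun w => v ≠ w ∧ ¬ G.Adj v w)) : ℝ) = n - 1 - G.degree v := by
  have : univ.filter (fun w => v ≠ w ∧ ¬ G.Adj v w) = univ \ (insert v (G.neighborFinset v)) := by
    ext w; simp [eq_comm]
  rw [this, Finset.cast_card_sdiff (Finset.subset_univ _), Finset.card_insert_of_notMem (by simp)]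
  simp
  ring

lemma S_bound (hfree : ¬ contains theta123 G) :
    (∃ i : ℝ, 2 ≤ i ∧ i ≤ G.degree v ∧ ∑ u ∈ G.neighborFinset v, (G.degree u : ℝ) ≤
      G.degree v + 2 * (G.degree v - i) + (n - 1 - G.degree v) * i) ∨
    (∑ u ∈ G.neighborFinset v, (G.degree u : ℝ) ≤
      3 * G.degree v + 2 * (n - 1 - G.degree v)) ∧
    (n = G.degree v + 2 → ∑ u ∈ G.neighborFinset v, (G.degree u : ℝ) ≤ 3 * G.degree v + 1) := by
  have hP := link_P4f hfree v
  have hT : ({u | (link G v).degree u ≠ 0} : Finset (Fin n)) ⊆ G.neighborFinset v := by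
    intro u hu
    simp only [Finset.mem_filter, Finset.mem_univ, true_and] at hu
    obtain ⟨x, hx⟩ := ((link G v).degree_pos_iff_exists_adj u).mp (Nat.pos_of_ne_zero hu)
    simpa using hx.1
  have hT' := Finset.card_le_card hT
  rw [SimpleGraph.card_neighborFinset_eq_degree] at hT'
  have hs := sum_deg_le (link G v) hP
  have hS := S_eq (G := G) v
  have hW := card_W (G := G) v
  have hout := outside v hfree
  have hTr : (#{u | (link G v).degree u ≠ 0} : ℝ) ≤ G.degree v := by exact_mod_cast hT'
  set t := #{u | (link G v).degree u ≠ 0}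
  set W := univ.filter (fun w => v ≠ w ∧ ¬ G.Adj v w) with hWd
  have memW : ∀ w ∈ W, v ≠ w ∧ ¬ G.Adj v w := by intro w hw; simpa [hWd] using hw
  rcases Nat.lt_or_ge (G.degree v - t) 2 with hi | hi
  · right
    have h2 : ∑ w ∈ W, (#(G.neighborFinset w ∩ G.neighborFinset v) : ℝ) ≤ #W • (2:ℝ) := by
      apply Finset.sum_le_card_nsmul
      intro w hw
      have : #(G.neighborFinset w ∩ G.neighborFinset v) ≤ 2 := by
        rcases hout w (memW w hw).1 (memW w hw).2 with h | h | h
        · omega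
        · omega
        · exact h.1
      exact_mod_cast this
    rw [nsmul_eq_mul, hW] at h2
    refine ⟨by linarith, fun hn => ?_⟩
    have hnr : (n : ℝ) = G.degree v + 2 := by exact_mod_cast hn
    have hW1 : #W = 1 := by
      have : (#W : ℝ) = 1 := by rw [hW, hnr]; ring
      exact_mod_cast this
    obtain ⟨w, hw⟩ := Finset.card_eq_one.mp hW1
    have hwW : w ∈ W := by rw [hw]; simp
    rw [hw, Finset.sum_singleton] at hS
    have small : #(G.neighborFinset w ∩ G.neighborFinset v) ≤ 1 →
        ∑ u ∈ G.neighborFinset v, (G.degree u : ℝ) ≤ 3 * G.degree v + 1 := by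
      intro h
      have : (#(G.neighborFinset w ∩ G.neighborFinset v) : ℝ) ≤ 1 := by exact_mod_cast h
      linarith
    rcases hout w (memW w hwW).1 (memW w hwW).2 with h | h | ⟨h, a, c, hac, ha, hc⟩
    · exact small h
    · exact small (by omega)
    · have h5 := sum_deg_le' (link G v) hP hac ha hc
      have : (#(G.neighborFinset w ∩ G.neighborFinset v) : ℝ) ≤ 2 := by exact_mod_cast h
      linarith
  · left
    refine ⟨G.degree v - t, ?_, ?_, ?_⟩
    · rw [← Nat.cast_sub hT']; exact_mod_cast hi
    · have : (0:ℝ) ≤ t := Nat.cast_nonneg _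
      linarith
    · have h2 : ∑ w ∈ W, (#(G.neighborFinset w ∩ G.neighborFinset v) : ℝ) ≤
          #W • ((G.degree v : ℝ) - t) := by
        apply Finset.sum_le_card_nsmul
        intro w hw
        rw [← Nat.cast_sub hT']
        have : #(G.neighborFinset w ∩ G.neighborFinset v) ≤ G.degree v - t := by
          rcases hout w (memW w hw).1 (memW w hw).2 with h | h | h
          · omega
          · omega
          · omega
        exact_mod_cast this
      rw [nsmul_eq_mul, hW] at h2
      linarith

end nondom

/-- numeric parameters: `b` with `(n-2) b (1+b) = 2`, `l = n + (n-2) b`. -/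
lemma params (n : ℕ) (hn : 6 ≤ n) : ∃ b l : ℝ, 0 < b ∧ b < 2 / 5 ∧
    ((n : ℝ) - 2) * (b * (1 + b)) = 2 ∧ l * b = 2 * b + 2 ∧ l = n + (n - 2) * b := by
  have hn' : (6:ℝ) ≤ n := by exact_mod_cast hn
  have hm : (0:ℝ) < n - 2 := by linarith
  have hq : 0 < 2 / ((n:ℝ) - 2) := by positivity
  have hq2 : 2 / ((n:ℝ) - 2) ≤ 1 / 2 := by rw [div_le_div_iff₀ hm (by norm_num)]; linarith
  set c := 2 / ((n:ℝ) - 2) with hc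
  have hmc : ((n:ℝ) - 2) * c = 2 := by rw [hc]; field_simp
  have hs := Real.sq_sqrt (show (0:ℝ) ≤ 1 + 4 * c by linarith)
  have hs0 := Real.sqrt_nonneg (1 + 4 * c)
  set s := Real.sqrt (1 + 4 * c)
  have hb : (s - 1) / 2 * (1 + (s - 1) / 2) = c := by nlinarith
  have hprod : ((n : ℝ) - 2) * ((s - 1) / 2 * (1 + (s - 1) / 2)) = 2 := by rw [hb, hmc]
  refine ⟨(s - 1) / 2, n + (n - 2) * ((s - 1) / 2), ?_, ?_, hprod, ?_, rfl⟩
  · nlinarith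
  · nlinarith
  · nlinarith

lemma lam_gt {m b : ℝ} (hm : 4 ≤ m) (hb0 : 0 < b) (hb : b < 2 / 5) (h : m * (b * (1 + b)) = 2) :
    1.4 < m * b := by nlinarith [mul_pos (show 0 < m by linarith) hb0]

lemma nondom_lt (n : ℕ) (hn : 6 ≤ n) (G : SimpleGraph (Fin n)) [DecidableRel G.Adj]
    (hfree : ¬ contains theta123 G) (l : ℝ) (hl : (n : ℝ) + 1.4 < l)
    (hdeg : ∀ v, G.degree v ≤ n - 2) : qrad G < l := by
  classical
  have hn' : (6:ℝ) ≤ n := by exact_mod_cast hn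
  have main : ∀ i, (G.degree i : ℝ) * (if G.degree i = 0 then 1 else (G.degree i : ℝ)) +
      ∑ j ∈ G.neighborFinset i, (if G.degree j = 0 then 1 else (G.degree j : ℝ)) <
      l * (if G.degree i = 0 then 1 else (G.degree i : ℝ)) := by
    intro v
    have hsum : ∑ j ∈ G.neighborFinset v, (if G.degree j = 0 then 1 else (G.degree j : ℝ)) =
        ∑ j ∈ G.neighborFinset v, (G.degree j : ℝ) := by
      refine Finset.sum_congr rfl fun j hj => ?_
      have := deg_pos_of_adj G (show G.Adj v j by simpa using hj)
      rw [if_neg (by omega)]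
    rw [hsum]
    by_cases h0 : G.degree v = 0
    · rw [Finset.card_eq_zero.mp ((G.card_neighborFinset_eq_degree v).trans h0)]
      simp [h0]; linarith
    rw [if_neg h0]
    have hd1 : (1:ℝ) ≤ G.degree v := by exact_mod_cast Nat.one_le_iff_ne_zero.mpr h0
    rcases Nat.lt_or_ge (G.degree v) 4 with h4 | h4
    · have hS : ∑ j ∈ G.neighborFinset v, (G.degree j : ℝ) ≤ #(G.neighborFinset v) • ((n:ℝ) - 2) := by
        apply Finset.sum_le_card_nsmul
        intro x _
        have := hdeg x
        have : G.degree x + 2 ≤ n := by omega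
        have : (G.degree x : ℝ) + 2 ≤ n := by exact_mod_cast this
        linarith
      rw [nsmul_eq_mul, SimpleGraph.card_neighborFinset_eq_degree] at hS
      have hd3 : (G.degree v : ℝ) ≤ 3 := by exact_mod_cast Nat.le_of_lt_succ h4
      nlinarith
    · have hd4 : (4:ℝ) ≤ G.degree v := by exact_mod_cast h4
      have hdn := hdeg v
      have hb := S_bound v hfree
      set S := ∑ j ∈ G.neighborFinset v, (G.degree j : ℝ)
      rcases Nat.lt_or_ge (G.degree v + 2) n with hk | hk
      · have hk' : (G.degree v : ℝ) + 3 ≤ n := by exact_mod_cast hk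
        set d : ℝ := ((G.degree v : ℕ) : ℝ)
        rcases hb with ⟨i, hi2, hid, hb⟩ | ⟨hb, -⟩
        · nlinarith [mul_nonneg (show 0 ≤ d - i by linarith) (show (0:ℝ) ≤ n - 3 - d by linarith)]
        · nlinarith [mul_nonneg (show 0 ≤ d - 4 by linarith) (show (0:ℝ) ≤ n - 3 - d by linarith)]
      · have hk2 : n = G.degree v + 2 := by omega
        have hk' : (n : ℝ) = G.degree v + 2 := by exact_mod_cast hk2
        rcases hb with ⟨i, hi2, hid, hb⟩ | ⟨-, hb⟩
        · rw [hk'] at hb hl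
          nlinarith
        · have hb := hb hk2
          rw [hk'] at hl
          nlinarith
  refine qrad_lt G l (by linarith) (fun i => if G.degree i = 0 then 1 else (G.degree i : ℝ))
    ?_ (fun i => (main i).le) (fun i => Or.inl (main i))
  intro i
  by_cases h0 : G.degree i = 0
  · simp [h0]
  · simp only [h0, if_false]; exact_mod_cast Nat.pos_of_ne_zero h0

lemma dom_lt (n : ℕ) (hn : 6 ≤ n) (G : SimpleGraph (Fin n)) [DecidableRel G.Adj]
    (hfree : ¬ contains theta123 G) (b l : ℝ) (hb0 : 0 < b) (hb : b < 2 / 5)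
    (hb2 : ((n : ℝ) - 2) * (b * (1 + b)) = 2) (hlb : l * b = 2 * b + 2)
    (hl : l = n + (n - 2) * b) (v : Fin n) (hv : ∀ u, u ≠ v → G.Adj v u)
    [DecidableRel (link G v).Adj]
    (hH : ∀ u, (link G v).degree u ≤ n - 3) : qrad G < l := by
  have hn' : (6:ℝ) ≤ n := by exact_mod_cast hn
  have hP := link_P4f hfree v
  obtain ⟨m, hm⟩ : ∃ m : ℝ, m = n - 2 := ⟨_, rfl⟩
  have hm4 : 4 ≤ m := by linarith
  have hnm : (n : ℝ) = m + 2 := by linarith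
  rw [← hm] at hb2 hl
  have hmb := lam_gt hm4 hb0 hb hb2
  obtain ⟨δ, hδ⟩ : ∃ δ : ℝ, δ = (1 - b) / (m + 1) := ⟨_, rfl⟩
  have hδ' : δ * (m + 1) = 1 - b := by rw [hδ]; field_simp
  have hδ0 : 0 < δ := by rw [hδ]; apply div_pos <;> linarith
  obtain ⟨κ, hκ⟩ : ∃ κ : ℝ, κ = b + δ := ⟨_, rfl⟩
  have hκ' : κ * (m + 1) = m * b + 1 := by rw [hκ]; linarith
  have hκ0 : 0 < κ := by linarith
  have hκm : κ + m * δ = 1 := by rw [hκ]; linarith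
  have ha : 1 < (l - 5) * κ := by
    have : (m + 1) * 1 < (m + 1) * ((l - 5) * κ) := by
      have e : (m + 1) * ((l - 5) * κ) = (l - 5) * (m * b + 1) := by rw [← hκ']; ring
      rw [e, hl, hnm]
      nlinarith
    exact lt_of_mul_lt_mul_left this (by linarith)
  have hmδ : δ * (m + 1 + m * b) < 1 + b := by
    have : (m + 1) * (δ * (m + 1 + m * b)) < (m + 1) * (1 + b) := by
      have e : (m + 1) * (δ * (m + 1 + m * b)) = (1 - b) * (m + 1 + m * b) := by
        rw [← hδ']; ring
      rw [e]
      nlinarith [mul_pos hb0 hb0]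
    exact lt_of_mul_lt_mul_left this (by linarith)
  have hdm : ∀ u, ((link G v).degree u : ℝ) ≤ m - 1 := by
    intro u
    have h1 := hH u
    have : (link G v).degree u + 3 ≤ n := by omega
    have : ((link G v).degree u : ℝ) + 3 ≤ n := by exact_mod_cast this
    linarith
  have hN : ∀ u, u ≠ v → G.neighborFinset u = insert v ((link G v).neighborFinset u) := by
    intro u hu
    ext c
    simp only [mem_neighborFinset, Finset.mem_insert, link_adj]
    constructor
    · intro h
      by_cases hc : c = v
      · exact Or.inl hc
      · exact Or.inr ⟨hv u hu, hv c hc, h⟩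
    · rintro (rfl | h)
      · exact (hv u hu).symm
      · exact h.2.2
  have hvN : ∀ u, v ∉ (link G v).neighborFinset u := by
    intro u; simp [link_adj]
  have hD : ∀ u, u ≠ v → (G.degree u : ℝ) = (link G v).degree u + 1 := by
    intro u hu
    rw [← SimpleGraph.card_neighborFinset_eq_degree, hN u hu, Finset.card_insert_of_notMem (hvN u)]
    simp
  have hsgv : sg (link G v) v = 0 := by
    apply sg_zero
    intro w hw
    exact absurd hw.1 (by simp)
  obtain ⟨x, hxdef⟩ : ∃ x : Fin n → ℝ,
    x = fun u => if u = v then 1 else κ + δ * sg (link G v) u := ⟨_, rfl⟩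
  have hxv : x v = 1 := by simp [hxdef]
  have hxu : ∀ u, u ≠ v → x u = κ + δ * sg (link G v) u := by
    intro u hu; simp [hxdef, hu]
  have hxN : ∀ u, ∀ w ∈ (link G v).neighborFinset u, x w = κ + δ * sg (link G v) w := by
    intro u w hw
    apply hxu
    rintro rfl
    exact hvN u hw
  have hsums : ∀ u, u ≠ v → (G.degree u : ℝ) * x u + ∑ j ∈ G.neighborFinset u, x j =
      ((link G v).degree u + 1) * (κ + δ * sg (link G v) u) + (1 +
        ∑ j ∈ (link G v).neighborFinset u, (κ + δ * sg (link G v) j)) := by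
    intro u hu
    rw [hD u hu, hxu u hu, hN u hu, Finset.sum_insert (hvN u), hxv,
      Finset.sum_congr rfl (hxN u)]
  -- constant-degree components
  have consts : ∀ u, u ≠ v → (link G v).degree u ≤ 2 →
      (∀ w, (link G v).Adj u w → (link G v).degree w = (link G v).degree u) →
      0 < x u ∧ (G.degree u : ℝ) * x u + ∑ j ∈ G.neighborFinset u, x j < l * x u := by
    intro u hu h2 hw
    have hsg := sg_zero _ hw
    have hsgw : ∀ w ∈ (link G v).neighborFinset u, κ + δ * sg (link G v) w = κ := by
      intro w hwm
      have huw : (link G v).Adj u w := by simpa using hwm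
      have hdw := hw w huw
      have : sg (link G v) w = 0 := by
        apply sg_zero
        intro y hy
        rcases struct_cases (link G v) hP w with h | ⟨h, h'⟩ | ⟨h, h'⟩ | ⟨h, z, hz, hz2, hz3⟩
        · have := deg_pos_of_adj _ huw; omega
        · exact h' y hy
        · have := h' u huw.symm; omega
        · have : u ∈ (link G v).neighborFinset w := by simpa using huw.symm
          rw [hz, Finset.mem_singleton] at this
          subst this; omega
      rw [this]; ring
    rw [hsums u hu, Finset.sum_congr rfl hsgw, hxu u hu, hsg]
    refine ⟨by linarith, ?_⟩
    have h2' : ((link G v).degree u : ℝ) ≤ 2 := by exact_mod_cast h2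
    simp only [Finset.sum_const, nsmul_eq_mul, SimpleGraph.card_neighborFinset_eq_degree]
    nlinarith
  have rows : ∀ u, u ≠ v →
      0 < x u ∧ (G.degree u : ℝ) * x u + ∑ j ∈ G.neighborFinset u, x j < l * x u := by
    intro u hu
    rcases struct_cases (link G v) hP u with h | ⟨h, h'⟩ | ⟨h, h'⟩ | ⟨h, z, hz, hz2, hz3⟩
    · apply consts u hu (by omega)
      intro w hw
      have := deg_pos_of_adj _ hw.symm
      omega
    · exact consts u hu (by omega) h'
    · have hsg := sg_center _ h h'
      have hsgw : ∀ w ∈ (link G v).neighborFinset u, κ + δ * sg (link G v) w = b := by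
        intro w hwm
        have huw : (link G v).Adj u w := by simpa using hwm
        have hdw := h' w huw
        have : sg (link G v) w = -1 := by
          refine sg_leaf (w := u) _ hdw ?_ h
          have huw' : u ∈ (link G v).neighborFinset w := by simpa using huw.symm
          obtain ⟨y, hy⟩ :=
            Finset.card_eq_one.mp (((link G v).card_neighborFinset_eq_degree w).trans hdw)
          rw [hy, Finset.mem_singleton] at huw'
          rw [hy, huw']
        rw [this, hκ]; ring
      rw [hsums u hu, Finset.sum_congr rfl hsgw, hxu u hu, hsg]
      simp only [Finset.sum_const, nsmul_eq_mul, SimpleGraph.card_neighborFinset_eq_degree]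
      have hr2 : (2:ℝ) ≤ (link G v).degree u := by exact_mod_cast h
      have hrm := hdm u
      set r : ℝ := (((link G v).degree u : ℕ) : ℝ)
      refine ⟨by positivity, ?_⟩
      obtain ⟨j, hj⟩ : ∃ j : ℝ, j = m - r := ⟨_, rfl⟩
      have hr : r = m - j := by linarith
      have hj1 : 1 ≤ j := by linarith
      have hp : κ + δ * r = 1 - j * δ := by rw [hr]; linarith
      rw [hp, hl, hnm, hr]
      have : 0 < j * (1 + b - δ * (j + 1 + m * b)) := by
        apply mul_pos (by linarith)
        nlinarith
      nlinarith
    · have hsg := sg_leaf _ h hz hz2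
      have hsgz := sg_center _ hz2 hz3
      rw [hsums u hu, hz, Finset.sum_singleton, hxu u hu, hsg, hsgz, h]
      have e : κ + δ * (-1) = b := by rw [hκ]; ring
      rw [e]
      refine ⟨hb0, ?_⟩
      have := hdm z
      push_cast
      nlinarith
  have hub : (G.degree v : ℝ) * x v + ∑ j ∈ G.neighborFinset v, x j = l * x v := by
    have hNv : G.neighborFinset v = univ.erase v := by
      ext c
      simp only [mem_neighborFinset, Finset.mem_erase, Finset.mem_univ, and_true]
      exact ⟨fun h => h.ne', hv c⟩
    have hd : (G.degree v : ℝ) = m + 1 := by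
      rw [← SimpleGraph.card_neighborFinset_eq_degree, hNv, Finset.card_erase_of_mem (mem_univ _)]
      rw [Nat.cast_sub (by simp; omega)]
      simp; linarith
    have hs : ∑ j ∈ univ.erase v, x j = (m + 1) * κ := by
      rw [Finset.sum_congr rfl (fun j hj => hxu j (Finset.ne_of_mem_erase hj)),
        Finset.sum_erase_eq_sub (mem_univ _), Finset.sum_add_distrib, ← Finset.mul_sum, sum_sg, hsgv]
      simp
      rw [hnm]; ring
    rw [hd, hNv, hs, hxv, hl, hnm]
    linarith
  refine qrad_lt G l (by rw [hl, hnm]; nlinarith) x ?_ ?_ ?_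
  · intro i
    by_cases hi : i = v
    · rw [hi, hxv]; norm_num
    · exact (rows i hi).1
  · intro i
    by_cases hi : i = v
    · rw [hi]; exact hub.le
    · exact (rows i hi).2.le
  · intro i
    by_cases hi : i = v
    · right
      obtain ⟨k, hk⟩ : ∃ k : Fin n, k ≠ v := by
        have : Nontrivial (Fin n) := Fin.nontrivial_iff_two_le.mpr (by omega)
        exact exists_ne v
      exact ⟨k, hi ▸ hv k hk, (rows k hk).2⟩
    · exact Or.inl (rows i hi).2

lemma Sgraph_adj (n : ℕ) (hn : 6 ≤ n) (a c : Fin n) : (Sgraph n 2).Adj a c ↔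
    a ≠ c ∧ (a = ⟨0, by omega⟩ ∨ a = ⟨1, by omega⟩ ∨ c = ⟨0, by omega⟩ ∨ c = ⟨1, by omega⟩) := by
  simp only [Sgraph, SimpleGraph.fromRel_adj, Fin.ext_iff, ne_eq]
  omega

theorem stmt1 (n : ℕ) (hn : 6 ≤ n) (G : SimpleGraph (Fin n))
    (hfree : ¬ contains theta123 G) :
    qrad G ≤ qrad (Sgraph n 2) ∧
      (qrad G = qrad (Sgraph n 2) → Nonempty (G ≃g Sgraph n 2)) := by
  classical
  have hn' : (6:ℝ) ≤ n := by exact_mod_cast hn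
  obtain ⟨b, l, hb0, hb, hb2, hlb, hl⟩ := params n hn
  have hmb := lam_gt (m := n - 2) (by linarith) hb0 hb hb2
  have hl0 : 0 < l := by linarith
  have hS : l ≤ qrad (Sgraph n 2) := by
    refine le_qrad _ l _ ?_ (book_row (Sgraph n 2) ⟨0, by omega⟩ ⟨1, by omega⟩ (by simp)
      (Sgraph_adj n hn) b l hlb hl)
    intro h
    have := congrFun h ⟨0, by omega⟩
    simp at this
  have fin : qrad G < l → qrad G ≤ qrad (Sgraph n 2) ∧
      (qrad G = qrad (Sgraph n 2) → Nonempty (G ≃g Sgraph n 2)) :=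
    fun h => ⟨(h.trans_le hS).le, fun e => absurd e (h.trans_le hS).ne⟩
  by_cases hdeg : ∀ v, G.degree v ≤ n - 2
  · exact fin (nondom_lt n hn G hfree l (by linarith) hdeg)
  push Not at hdeg
  obtain ⟨v, hv⟩ := hdeg
  have hdomd : ∀ w : Fin n, n - 2 < G.degree w → ∀ u, u ≠ w → G.Adj w u := by
    intro w hw u hu
    by_contra hadj
    have hsub : G.neighborFinset w ⊆ (univ.erase w).erase u := by
      intro c hc
      have hc' : G.Adj w c := by simpa using hc
      simp only [Finset.mem_erase, Finset.mem_univ, and_true]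
      exact ⟨by rintro rfl; exact hadj hc', hc'.ne'⟩
    have h1 := Finset.card_le_card hsub
    rw [SimpleGraph.card_neighborFinset_eq_degree,
      Finset.card_erase_of_mem (by simp [hu]), Finset.card_erase_of_mem (mem_univ _)] at h1
    simp at h1
    omega
  have hvd := hdomd v hv
  by_cases hH : ∀ u, (link G v).degree u ≤ n - 3
  · exact fin (dom_lt n hn G hfree b l hb0 hb hb2 hlb hl v hvd hH)
  push Not at hH
  obtain ⟨u, hu⟩ := hH
  have huv : u ≠ v := by
    rintro rfl
    rw [link_degree_zero u u (by simp)] at hu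
    omega
  have hud : ∀ w, w ≠ u → G.Adj u w := by
    apply hdomd
    have hsub : insert v ((link G v).neighborFinset u) ⊆ G.neighborFinset u := by
      intro c hc
      simp only [Finset.mem_insert, mem_neighborFinset] at hc ⊢
      rcases hc with rfl | h
      · exact (hvd u huv).symm
      · exact h.2.2
    have h1 := Finset.card_le_card hsub
    rw [Finset.card_insert_of_notMem (by simp [link_adj]),
      SimpleGraph.card_neighborFinset_eq_degree, SimpleGraph.card_neighborFinset_eq_degree] at h1
    omega
  have hG : ∀ a c, G.Adj a c ↔ a ≠ c ∧ (a = u ∨ a = v ∨ c = u ∨ c = v) := by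
    intro a c
    constructor
    · intro hac
      refine ⟨hac.ne, ?_⟩
      by_contra hne
      push Not at hne
      obtain ⟨h1, h2, h3, h4⟩ := hne
      obtain ⟨e, he⟩ : ∃ e : Fin n, e ∉ ({a, c, u, v} : Finset (Fin n)) := by
        by_contra hall
        push Not at hall
        have : (univ : Finset (Fin n)) ⊆ {a, c, u, v} := fun e _ => hall e
        have h5 := Finset.card_le_card this
        have h6 : #({a, c, u, v} : Finset (Fin n)) ≤ 4 := Finset.card_le_four
        simp at h5
        omega
      simp only [Finset.mem_insert, Finset.mem_singleton, not_or] at he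
      obtain ⟨e1, e2, e3, e4⟩ := he
      exact link_P4f hfree v e u a c e1 e2 h3.symm
        ⟨hvd e e4, hvd u huv, (hud e e3).symm⟩ ⟨hvd u huv, hvd a h2, hud a h1⟩
        ⟨hvd a h2, hvd c h4, hac⟩
    · rintro ⟨hac, rfl | rfl | rfl | rfl⟩
      · exact hud c hac.symm
      · exact hvd c hac.symm
      · exact (hud a hac).symm
      · exact (hvd a hac).symm
  constructor
  · refine le_trans (qrad_le_s1 G l hl0 _ ?_ fun i => (book_row G u v huv hG b l hlb hl i).le) hS
    intro i
    show 0 < (if i = u ∨ i = v then (1:ℝ) else b)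
    split_ifs
    · norm_num
    · exact hb0
  · intro _
    let z0 : Fin n := ⟨0, by omega⟩
    let z1 : Fin n := ⟨1, by omega⟩
    have z01 : z0 ≠ z1 := by simp [z0, z1]
    obtain ⟨σ, hσu, hσv⟩ : ∃ σ : Equiv.Perm (Fin n), σ u = z0 ∧ σ v = z1 := by
      let σ1 : Equiv.Perm (Fin n) := Equiv.swap u z0
      have h1 : σ1 u = z0 := Equiv.swap_apply_left _ _
      have hne : σ1 v ≠ z0 := by
        rw [← h1]; exact fun h => huv (σ1.injective h).symm
      refine ⟨σ1.trans (Equiv.swap (σ1 v) z1), ?_, ?_⟩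
      · rw [Equiv.trans_apply, h1]
        exact Equiv.swap_apply_of_ne_of_ne hne.symm z01
      · rw [Equiv.trans_apply]
        exact Equiv.swap_apply_left _ _
    refine ⟨⟨σ, ?_⟩⟩
    intro a c
    rw [Sgraph_adj n hn, hG]
    change σ a ≠ σ c ∧ (σ a = z0 ∨ σ a = z1 ∨ σ c = z0 ∨ σ c = z1) ↔ _
    rw [← hσu, ← hσv]
    simp only [ne_eq, σ.injective.eq_iff]
end
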